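/- arXiv:1912.04647 — 2 statements merged into one kernel-verified Lean document; each statement's English description precedes it below -/
import Mathlib

section
/- Let p be a prime with p ≡ 1 (mod 4), let K = ℚ(√p) and let h = h(p) be the class number of K (which is odd). Let t, u be positive integers such that ε = (t + u√p)/2 is the fundamental unit of K, i.e. ε is a unit of the ring of integers of K with ε > 1 under the real embedding, and every unit of the ring of integers of K equals ±ε^n for some n ∈ ℤ. Let a be a positive integer with gcd(a, p) = 1 and set Z_a := Σ_{j=1}^{p−1} j·p^{(j+1)a−1}. Then in 𝔽_p one has 2 · Tr(θ^{Z_a}) = (−1)^{(h+1)/2} · (−2a/p) · t, where (·/p) denotes the Legendre symbol. -/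
open NumberField

/-- `Z_a = ∑_{j=1}^{p-1} j p^{(j+1)a-1}`, a positive integer representing
`ζ(𝔽_p, a) = (1 - p^{-a})^{-1}` modulo `k_p = (p^p-1)/(p-1)`. -/
def ZetaRep (p a : ℕ) : ℕ := ∑ j ∈ Finset.Icc 1 (p - 1), j * p ^ ((j + 1) * a - 1)

section Charlier

open Polynomial

variable {R : Type*} [CommRing R]

/-- The polynomials obtained from `1` by iterating `P ↦ (X + a) P(X + a) - P`. -/
noncomputable def shiftCharlier (a : R) : ℕ → R[X]
  | 0 => 1
  | n + 1 => (X + C a) * (shiftCharlier a n).comp (X + C a) - shiftCharlier a n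

theorem shiftCharlier_monic_natDegree [Nontrivial R] (a : R) (n : ℕ) :
    (shiftCharlier a n).Monic ∧ (shiftCharlier a n).natDegree = n := by
  induction n with
  | zero => simp [shiftCharlier]
  | succ n ih =>
    obtain ⟨hm, hd⟩ := ih
    have hmc : ((shiftCharlier a n).comp (X + C a)).Monic := hm.comp_X_add_C a
    have hdc : ((shiftCharlier a n).comp (X + C a)).natDegree = n := by
      rw [← taylor_apply, natDegree_taylor, hd]
    have hm' : ((X + C a) * (shiftCharlier a n).comp (X + C a)).Monic :=
      (monic_X_add_C a).mul hmc
    have hd' : ((X + C a) * (shiftCharlier a n).comp (X + C a)).natDegree = n + 1 := by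
      rw [(monic_X_add_C a).natDegree_mul hmc, hdc, natDegree_X_add_C, add_comm]
    have hlt : (shiftCharlier a n).degree <
        ((X + C a) * (shiftCharlier a n).comp (X + C a)).degree := by
      rw [degree_eq_natDegree hm.ne_zero, degree_eq_natDegree hm'.ne_zero, hd, hd']
      exact_mod_cast Nat.lt_succ_self n
    refine ⟨hm'.sub_of_left hlt, ?_⟩
    rw [shiftCharlier, natDegree_sub_eq_left_of_natDegree_lt (by rw [hd, hd']; omega), hd']

theorem shiftCharlier_comp_sub (a : R) (n : ℕ) :
    (shiftCharlier a (n + 1)).comp (X - C a) - shiftCharlier a (n + 1) =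
      C (-a * (n + 1)) * shiftCharlier a n := by
  have key : ∀ P : R[X], (P.comp (X + C a)).comp (X - C a) = P := by
    intro P; rw [comp_assoc]; simp
  have key' : ∀ P : R[X], (P.comp (X - C a)).comp (X + C a) = P := by
    intro P; rw [comp_assoc]; simp
  induction n with
  | zero =>
    simp [shiftCharlier]
  | succ n ih =>
    have h1 : (shiftCharlier a (n + 1)).comp (X - C a) =
        shiftCharlier a (n + 1) + C (-a * (n + 1)) * shiftCharlier a n := by
      rw [← ih]; ring
    have h2 : (shiftCharlier a (n + 1)).comp (X + C a) = shiftCharlier a (n + 1) -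
        C (-a * (n + 1)) * (shiftCharlier a n).comp (X + C a) := by
      have := congrArg (fun P => P.comp (X + C a)) ih
      simp only [sub_comp, mul_comp, C_comp, key'] at this
      rw [← this]; ring
    have h3 : (X + C a) * (shiftCharlier a n).comp (X + C a) =
        shiftCharlier a (n + 1) + shiftCharlier a n := by
      rw [shiftCharlier]; ring
    rw [shiftCharlier, sub_comp, mul_comp, key, h2]
    simp only [add_comp, X_comp, C_comp]
    rw [h1]
    have h4 : (X + C a) * (shiftCharlier a (n + 1) -
        C (-a * (n + 1)) * (shiftCharlier a n).comp (X + C a)) =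
        (X + C a) * shiftCharlier a (n + 1) -
        C (-a * (n + 1)) * (shiftCharlier a (n + 1) + shiftCharlier a n) := by
      rw [← h3]; ring
    rw [h4]
    simp only [Nat.cast_add, Nat.cast_one, C_mul, C_add, C_neg, C_1]
    ring

variable {M : Type*} [AddCommGroup M] [Module R M] (a : R) (l : R[X] →ₗ[R] M)
  (hl : ∀ P : R[X], l ((X + C a) * P.comp (X + C a)) = l P)

include hl in
theorem shiftCharlier_functional_succ_mul (n : ℕ) (Q : R[X]) :
    l (shiftCharlier a (n + 1) * Q) = l (shiftCharlier a n * (Q.comp (X - C a) - Q)) := by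
  have key' : (Q.comp (X - C a)).comp (X + C a) = Q := by
    rw [comp_assoc]; simp
  have h := hl (shiftCharlier a n * Q.comp (X - C a))
  rw [mul_comp, key'] at h
  rw [mul_sub, map_sub, ← h, ← map_sub, shiftCharlier]
  congr 1
  ring

include hl in
theorem shiftCharlier_functional_mul (n k : ℕ) :
    l (shiftCharlier a (n + k) * shiftCharlier a n) =
      if k = 0 then ((-a) ^ n * (n.factorial : R)) • l 1 else 0 := by
  induction n with
  | zero =>
    rcases k with _ | k
    · simp [shiftCharlier]
    · rw [← add_assoc, shiftCharlier_functional_succ_mul a l hl]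
      simp [shiftCharlier]
  | succ n ih =>
    rw [show n + 1 + k = (n + k) + 1 by ring, shiftCharlier_functional_succ_mul a l hl,
      shiftCharlier_comp_sub, mul_left_comm, ← smul_eq_C_mul, map_smul, ih]
    split_ifs
    · rw [smul_smul]
      congr 1
      push_cast [Nat.factorial_succ]
      ring
    · simp

include hl in
theorem shiftCharlier_functional_mul_eq_ite (n k : ℕ) :
    l (shiftCharlier a n * shiftCharlier a k) =
      if n = k then ((-a) ^ n * (n.factorial : R)) • l 1 else 0 := by
  rcases le_total n k with h | h
  · obtain ⟨d, rfl⟩ := Nat.exists_eq_add_of_le h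
    rw [mul_comm, shiftCharlier_functional_mul a l hl]
    simp
  · obtain ⟨d, rfl⟩ := Nat.exists_eq_add_of_le h
    rw [shiftCharlier_functional_mul a l hl]
    rcases d with _ | d <;> simp

end Charlier

section ArtinSchreier

open Polynomial Matrix

theorem ZMod.prod_range_natCast {p : ℕ} [Fact p.Prime] {M : Type*} [CommMonoid M]
    (g : ZMod p → M) : ∏ i ∈ Finset.range p, g i = ∏ c : ZMod p, g c := by
  refine Finset.prod_nbij' (fun i => (i : ZMod p)) (fun c => c.val) (by simp) ?_ ?_ (by simp)
    (by simp)
  · intro c _; simpa using ZMod.val_lt c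
  · intro i hi; exact ZMod.val_cast_of_lt (Finset.mem_range.1 hi)

theorem ZMod.prod_X_add_C (p : ℕ) [Fact p.Prime] :
    ∏ c : ZMod p, (X + C c) = (X ^ p - X : (ZMod p)[X]) := by
  have h := FiniteField.roots_X_pow_card_sub_X (ZMod p)
  rw [ZMod.card p] at h
  have hp : 1 < p := (Fact.out : p.Prime).one_lt
  have hm : (X ^ p - X : (ZMod p)[X]).Monic := by
    apply monic_X_pow_sub
    rw [degree_X]
    exact_mod_cast hp
  have := prod_multiset_X_sub_C_of_monic_of_roots_card_eq hm (by
    rw [h, FiniteField.X_pow_card_sub_X_natDegree_eq _ hp]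
    simp [ZMod.card])
  rw [h] at this
  rw [← this, ← Equiv.prod_comp (Equiv.neg (ZMod p))]
  simp only [Equiv.neg_apply, C_neg, ← sub_eq_add_neg]
  rfl

variable {p : ℕ} [Fact p.Prime] {F : Type*} [Field F] [Algebra (ZMod p) F] {θ : F}

theorem artinSchreier_prod_eq_one (hθ : θ ^ p = θ + 1) :
    ∏ c : ZMod p, (θ + algebraMap (ZMod p) F c) = 1 := by
  have h := congrArg (aeval θ) (ZMod.prod_X_add_C p)
  rw [map_prod] at h
  simpa [hθ] using h

theorem artinSchreier_pow_pow (hθ : θ ^ p = θ + 1) (k : ℕ) : θ ^ p ^ k = θ + k := by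
  have : CharP F p := charP_of_injective_algebraMap (algebraMap (ZMod p) F).injective p
  induction k with
  | zero => simp
  | succ k ih =>
    rw [pow_succ, pow_mul, ih, add_pow_char, hθ, ← frobenius_def, map_natCast]
    push_cast; ring

theorem artinSchreier_zetaRep_pow (hθ : θ ^ p = θ + 1) {a : ℕ} (ha : 1 ≤ a)
    (hap : Nat.gcd a p = 1) :
    (θ ^ ZetaRep p a) ^ p ^ a = (θ + a) * θ ^ ZetaRep p a := by
  have : CharP F p := charP_of_injective_algebraMap (algebraMap (ZMod p) F).injective p
  have hp : p.Prime := Fact.out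
  have hinj : Function.Injective (frobenius F p) := (frobenius F p).injective
  have ha0 : (a : ZMod p) ≠ 0 := by
    rw [Ne, ZMod.natCast_eq_zero_iff]
    intro h
    have := Nat.gcd_eq_right h
    rw [hap] at this
    exact hp.one_lt.ne this
  set g : ℕ → F := fun j => θ + ((j + 1) * a : ℕ) with hg
  have hbeta : (θ ^ ZetaRep p a) ^ p = ∏ j ∈ Finset.range p, g j ^ j := by
    rw [← pow_mul, ZetaRep, Finset.sum_mul]
    have : ∀ j ∈ Finset.Icc 1 (p - 1), j * p ^ ((j + 1) * a - 1) * p = p ^ ((j + 1) * a) * j := by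
      intro j _
      have : 1 ≤ (j + 1) * a := Nat.one_le_iff_ne_zero.2 (by positivity)
      conv_rhs => rw [← Nat.sub_add_cancel this, pow_succ]
      ring
    rw [Finset.sum_congr rfl this, ← Finset.prod_pow_eq_pow_sum,
      show Finset.Icc 1 (p - 1) = Finset.Ico 1 p by
        ext x; simp only [Finset.mem_Icc, Finset.mem_Ico]; have := hp.one_lt; omega]
    rw [Finset.range_eq_Ico, Finset.prod_eq_prod_Ico_succ_bot hp.pos]
    simp only [pow_zero, one_mul]
    refine Finset.prod_congr rfl fun j _ => ?_
    rw [pow_mul, artinSchreier_pow_pow hθ]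
  have hgs : ∀ j, g j ^ p ^ a = g (j + 1) := by
    intro j
    simp only [hg]
    rw [add_pow_char_pow, artinSchreier_pow_pow hθ, ← iterateFrobenius_def, map_natCast]
    push_cast; ring
  have hbeta' : ((θ ^ ZetaRep p a) ^ p) ^ p ^ a = ∏ j ∈ Finset.range p, g (j + 1) ^ j := by
    rw [hbeta, ← Finset.prod_pow]
    refine Finset.prod_congr rfl fun j _ => ?_
    rw [← pow_mul, mul_comm, pow_mul, hgs]
  have hone : ∏ j ∈ Finset.range p, g (j + 1) = 1 := by
    have h1 := ZMod.prod_range_natCast (p := p)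
      (fun c => θ + algebraMap (ZMod p) F ((c + 2) * a))
    rw [← artinSchreier_prod_eq_one hθ]
    refine Eq.trans ?_ (h1.trans ?_)
    · refine Finset.prod_congr rfl fun j _ => ?_
      simp only [hg, map_mul, map_add, map_natCast, map_ofNat]
      push_cast
      ring
    · refine Function.Bijective.prod_comp (e := fun c : ZMod p => (c + 2) * a) ?_
        (fun c => θ + algebraMap (ZMod p) F c)
      refine (Finite.injective_iff_bijective).1 fun x y h => ?_
      simpa using mul_right_cancel₀ ha0 h
  have hgp : g p ^ p = θ + 1 + a := by
    simp only [hg]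
    rw [add_pow_char, hθ, ← frobenius_def, map_natCast]
    push_cast
    simp
  have hmain : ∏ j ∈ Finset.range p, g (j + 1) ^ j = (∏ j ∈ Finset.range p, g j ^ j) * g p ^ p := by
    calc ∏ j ∈ Finset.range p, g (j + 1) ^ j
        = (∏ j ∈ Finset.range p, g (j + 1) ^ j) * ∏ j ∈ Finset.range p, g (j + 1) := by
          rw [hone, mul_one]
      _ = ∏ j ∈ Finset.range p, g (j + 1) ^ (j + 1) := by
          rw [← Finset.prod_mul_distrib]
          exact Finset.prod_congr rfl fun j _ => (pow_succ _ _).symm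
      _ = ∏ j ∈ Finset.range (p + 1), g j ^ j := by
          rw [Finset.prod_range_succ']; simp
      _ = _ := Finset.prod_range_succ _ _
  apply hinj
  rw [frobenius_def, frobenius_def, mul_pow, add_pow_char, hθ, ← frobenius_def _ (a : F),
    map_natCast, ← pow_mul, mul_comm (p ^ a), pow_mul, hbeta', hmain, hgp, hbeta]
  ring

theorem trace_zetaRep_mul_eq_prod_factorial [Fintype F] (hcard : Fintype.card F = p ^ p)
    (hθ : θ ^ p = θ + 1) {a : ℕ} (ha : 1 ≤ a) (hap : Nat.gcd a p = 1) :
    ((-(a : ZMod p)) ^ (∑ n ∈ Finset.range p, n)) *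
      Algebra.trace (ZMod p) F (θ ^ ZetaRep p a) =
        ∏ n ∈ Finset.range p, (n.factorial : ZMod p) := by
  have : CharP F p := charP_of_injective_algebraMap (algebraMap (ZMod p) F).injective p
  have hp : p.Prime := Fact.out
  have hfin : Module.finrank (ZMod p) F = p := by
    have := Module.card_eq_pow_finrank (K := ZMod p) (V := F)
    rw [ZMod.card, hcard] at this
    exact (Nat.pow_right_injective hp.two_le this).symm
  set β := θ ^ ZetaRep p a with hβ
  have htr : ∀ y : F, algebraMap (ZMod p) F (Algebra.trace (ZMod p) F y) =
      ∑ i : Fin p, y ^ p ^ (i : ℕ) := by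
    intro y
    rw [FiniteField.algebraMap_trace_eq_sum_pow, hfin, Nat.card_zmod, Finset.sum_range]
  let l : (ZMod p)[X] →ₗ[ZMod p] ZMod p :=
    (Algebra.trace (ZMod p) F).comp ((LinearMap.mulLeft (ZMod p) β).comp
      (aeval θ).toLinearMap)
  have hl_apply : ∀ P : (ZMod p)[X], l P = Algebra.trace (ZMod p) F (β * aeval θ P) := fun P => rfl
  have haev : ∀ (P : (ZMod p)[X]) (k : ℕ), aeval (θ + k) P = (aeval θ P) ^ p ^ k := by
    intro P k
    rw [← artinSchreier_pow_pow hθ, ← iterateFrobenius_def, ← iterateFrobenius_def,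
      aeval_def, aeval_def, hom_eval₂]
    congr 1
    exact Subsingleton.elim _ _
  have htr_frob : ∀ (y : F), Algebra.trace (ZMod p) F (y ^ p ^ a) = Algebra.trace (ZMod p) F y := by
    intro y
    have h1 : ∀ y : F, Algebra.trace (ZMod p) F (y ^ p) = Algebra.trace (ZMod p) F y := by
      intro y
      have := Algebra.trace_eq_of_algEquiv
        (FiniteField.frobeniusAlgEquivOfAlgebraic (ZMod p) F) y
      simpa [ZMod.card] using this
    have h2 : ∀ k : ℕ, Algebra.trace (ZMod p) F (y ^ p ^ k) = Algebra.trace (ZMod p) F y := by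
      intro k
      induction k with
      | zero => simp
      | succ k ih => rw [pow_succ, pow_mul, h1, ih]
    exact h2 a
  have hl : ∀ P : (ZMod p)[X], l ((X + C (a : ZMod p)) * P.comp (X + C (a : ZMod p))) = l P := by
    intro P
    rw [hl_apply, hl_apply, map_mul (aeval θ), aeval_comp]
    have : aeval θ (X + C (a : ZMod p)) = θ + a := by simp
    rw [this, haev, ← mul_assoc, mul_comm β, ← artinSchreier_zetaRep_pow hθ ha hap, ← mul_pow,
      htr_frob]
  set Pn : Fin p → F[X] := fun n => (shiftCharlier (a : ZMod p) n).map (algebraMap (ZMod p) F)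
  set v : Fin p → F := fun i => θ + (i : ℕ)
  set M : Matrix (Fin p) (Fin p) F := of fun i j => eval (v i) (Pn j) with hM
  have hMdet : M.det = algebraMap (ZMod p) F (∏ n ∈ Finset.range p, (n.factorial : ZMod p)) := by
    rw [hM, ← det_eval_matrixOfPolynomials_eq_det_vandermonde v Pn]
    · have : v = fun i => (fun i : Fin p => ((i : ℕ) : F)) i + θ := by
        ext i; simp [v, add_comm]
      rw [this, det_vandermonde_add]
      obtain ⟨q, hq⟩ : ∃ q, p = q + 1 := ⟨p - 1, by have := hp.pos; omega⟩
      have : ∀ (n : ℕ), n = q + 1 → (vandermonde fun i : Fin n => ((i : ℕ) : F)).det =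
          algebraMap (ZMod p) F (∏ n ∈ Finset.range n, (n.factorial : ZMod p)) := by
        rintro n rfl
        rw [det_vandermonde_id_eq_superFactorial, ← Nat.prod_range_succ_factorial]
        simp only [Nat.cast_prod, map_prod, map_natCast]
      exact this p hq
    · intro i
      rw [natDegree_map]
      exact (shiftCharlier_monic_natDegree _ _).2
    · intro i
      exact (shiftCharlier_monic_natDegree _ _).1.map _
  have hMapply : ∀ i j, M i j = (aeval θ (shiftCharlier (a : ZMod p) j)) ^ p ^ (i : ℕ) := by
    intro i j
    rw [← haev]
    simp [hM, v, Pn, aeval_def, eval_map]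
  have hgram : Mᵀ * diagonal (fun i : Fin p => β ^ p ^ (i : ℕ)) * M =
      diagonal (fun i : Fin p => algebraMap (ZMod p) F
        (((-(a : ZMod p)) ^ (i : ℕ) * ((i : ℕ).factorial : ZMod p)) * l 1)) := by
    ext j k
    rw [mul_apply, diagonal_apply]
    have h := shiftCharlier_functional_mul_eq_ite (a : ZMod p) l hl j k
    have h2 : ∑ i, (Mᵀ * diagonal (fun i : Fin p => β ^ p ^ (i : ℕ))) j i * M i k =
        algebraMap (ZMod p) F
          (l (shiftCharlier (a : ZMod p) j * shiftCharlier (a : ZMod p) k)) := by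
      rw [hl_apply, htr]
      refine Finset.sum_congr rfl fun i _ => ?_
      rw [mul_diagonal, transpose_apply, hMapply, hMapply, map_mul, mul_pow, mul_pow]
      ring
    rw [h2, h]
    simp only [Fin.val_inj]
    split_ifs with hjk
    · rw [smul_eq_mul]
    · simp
  have hnorm : ∏ i : Fin p, β ^ p ^ (i : ℕ) = 1 := by
    have : ∏ i : Fin p, θ ^ p ^ (i : ℕ) = 1 := by
      rw [← artinSchreier_prod_eq_one hθ, ← ZMod.prod_range_natCast, Finset.prod_range]
      refine Finset.prod_congr rfl fun i _ => ?_
      rw [artinSchreier_pow_pow hθ]; simp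
    rw [← one_pow (ZetaRep p a), ← this, ← Finset.prod_pow]
    exact Finset.prod_congr rfl fun i _ => by rw [hβ, ← pow_mul, ← pow_mul, mul_comm]
  have hdet := congrArg det hgram
  rw [det_mul, det_mul, det_transpose, det_diagonal, det_diagonal, hnorm, hMdet, mul_one,
    ← map_prod, ← map_mul] at hdet
  have hdet' := (algebraMap (ZMod p) F).injective hdet
  rw [Finset.prod_mul_distrib, Finset.prod_const, Finset.card_univ, Fintype.card_fin,
    ZMod.pow_card, Finset.prod_mul_distrib,
    ← Finset.prod_range (fun i => (-(a : ZMod p)) ^ i),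
    ← Finset.prod_range (fun i => (i.factorial : ZMod p)), Finset.prod_pow_eq_pow_sum] at hdet'
  have hl1 : l 1 = Algebra.trace (ZMod p) F β := by rw [hl_apply]; simp
  have hne : ∏ n ∈ Finset.range p, (n.factorial : ZMod p) ≠ 0 := by
    refine Finset.prod_ne_zero_iff.2 fun n hn => ?_
    rw [Ne, ZMod.natCast_eq_zero_iff, hp.dvd_factorial, not_le]
    exact Finset.mem_range.1 hn
  rw [hl1] at hdet'
  refine mul_right_cancel₀ hne ?_
  rw [hdet']; ring

end ArtinSchreier

theorem ZMod.factorial_mul_factorial_sub {p : ℕ} [Fact p.Prime] {k : ℕ} (hk : k < p) :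
    (k.factorial : ZMod p) * ((p - 1 - k).factorial : ZMod p) = (-1) ^ (k + 1) := by
  have hp : p.Prime := Fact.out
  induction k with
  | zero => simp [ZMod.wilsons_lemma]
  | succ k ih =>
    have h := ih (by omega)
    rw [show p - 1 - k = (p - 1 - (k + 1)) + 1 by omega, Nat.factorial_succ] at h
    rw [pow_succ, ← h, Nat.factorial_succ]
    have : ((p - 1 - (k + 1) + 1 : ℕ) : ZMod p) = -((k + 1 : ℕ) : ZMod p) := by
      rw [eq_neg_iff_add_eq_zero, ← Nat.cast_add, show p - 1 - (k + 1) + 1 + (k + 1) = p by omega]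
      simp
    push_cast at this ⊢
    rw [this]
    ring

theorem ZMod.prod_range_factorial {p : ℕ} [Fact p.Prime] (hp4 : p % 4 = 1) :
    ∏ n ∈ Finset.range p, (n.factorial : ZMod p) =
      (-1) ^ (p / 4) * ((p / 2).factorial : ZMod p) := by
  obtain ⟨q, hq⟩ : ∃ q, p = 4 * q + 1 := ⟨p / 4, by omega⟩
  have hp : p.Prime := Fact.out
  have h1 : Finset.range p = Finset.range (2 * q + 1 + 2 * q) := by congr 1; omega
  rw [h1, Finset.prod_range_add, Finset.prod_range_succ,
    ← Finset.prod_range_reflect (fun x => (((2 * q + 1 + x).factorial : ℕ) : ZMod p)),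
    mul_right_comm, ← Finset.prod_mul_distrib]
  have h2 : ∀ k ∈ Finset.range (2 * q), (k.factorial : ZMod p) *
      (((2 * q + 1 + (2 * q - 1 - k)).factorial : ℕ) : ZMod p) = (-1) ^ (k + 1) := by
    intro k hk
    rw [Finset.mem_range] at hk
    rw [← ZMod.factorial_mul_factorial_sub (k := k) (by omega),
      show 2 * q + 1 + (2 * q - 1 - k) = p - 1 - k by omega]
  rw [Finset.prod_congr rfl h2, show p / 4 = q by omega, show p / 2 = 2 * q by omega]
  congr 1
  clear h2 h1 hq
  induction q with
  | zero => simp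
  | succ q ih =>
    rw [show 2 * (q + 1) = 2 * q + 1 + 1 by ring, Finset.prod_range_succ, Finset.prod_range_succ,
      ih, pow_succ, pow_succ _ (2 * q + 1), pow_succ _ (2 * q)]
    simp [pow_mul, pow_succ]

theorem trace_zetaRep_eq_legendreSym_mul_factorial {p : ℕ} [Fact p.Prime] (hp4 : p % 4 = 1)
    {F : Type*} [Field F] [Fintype F] [Algebra (ZMod p) F] (hcard : Fintype.card F = p ^ p)
    {θ : F} (hθ : θ ^ p = θ + 1) {a : ℕ} (ha : 1 ≤ a) (hap : Nat.gcd a p = 1) :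
    Algebra.trace (ZMod p) F (θ ^ ZetaRep p a) =
      ((legendreSym p (-2 * a) : ℤ) : ZMod p) * ((p / 2).factorial : ZMod p) := by
  have hp : p.Prime := Fact.out
  have h := trace_zetaRep_mul_eq_prod_factorial hcard hθ ha hap
  rw [ZMod.prod_range_factorial hp4, Finset.sum_range_id,
    show p * (p - 1) / 2 = p * (p / 2) by
      rw [Nat.mul_div_assoc _ (by omega)]; congr 1; omega, pow_mul, ZMod.pow_card] at h
  have hleg : ((legendreSym p (-a) : ℤ) : ZMod p) = (-(a : ZMod p)) ^ (p / 2) := by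
    rw [legendreSym.eq_pow]; push_cast; rfl
  have h2 : ((legendreSym p 2 : ℤ) : ZMod p) = (-1) ^ (p / 4) := by
    rw [legendreSym.at_two (by omega), ZMod.χ₈_nat_eq_if_mod_eight]
    rcases (by omega : p % 8 = 1 ∨ p % 8 = 5) with h8 | h8
    · rw [Even.neg_one_pow (by rw [Nat.even_iff]; omega)]
      simp [h8, (by omega : p % 2 = 1)]
    · rw [Odd.neg_one_pow (by rw [Nat.odd_iff]; omega)]
      simp [h8, (by omega : p % 2 = 1)]
  have hsq : ((legendreSym p (-a) : ℤ) : ZMod p) ^ 2 = 1 := by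
    rw [← Int.cast_pow, legendreSym.sq_one, Int.cast_one]
    push_cast
    rw [Ne, neg_eq_zero, ZMod.natCast_eq_zero_iff]
    intro h
    have := Nat.gcd_eq_right h
    rw [hap] at this
    exact hp.one_lt.ne this
  rw [show (-2 * a : ℤ) = 2 * (-a) by ring, legendreSym.mul, Int.cast_mul, h2]
  rw [← hleg] at h
  linear_combination ((legendreSym p (-a) : ℤ) : ZMod p) * h -
    (Algebra.trace (ZMod p) F (θ ^ ZetaRep p a)) * hsq

section CyclotomicCongruence

open Polynomial

variable {p : ℕ} [Fact p.Prime]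

theorem ZMod.natCast_factorial_half_sq (hp4 : p % 4 = 1) :
    ((p / 2).factorial : ZMod p) ^ 2 = -1 := by
  have h := ZMod.factorial_mul_factorial_sub (p := p) (k := p / 2) (by omega)
  rw [show p - 1 - p / 2 = p / 2 by omega, ← sq] at h
  rw [h, Odd.neg_one_pow (by rw [Nat.odd_iff]; omega)]

theorem X_sub_one_pow_dvd_map_of_aeval_eq_zero {L : Type*} [Field L] [CharZero L] {ζ : L}
    (hζ : IsPrimitiveRoot ζ p) {Q : ℤ[X]} (hQ : aeval ζ Q = 0) :
    (X - 1) ^ (p - 1) ∣ Q.map (Int.castRingHom (ZMod p)) := by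
  have hp : p.Prime := Fact.out
  have h1 : cyclotomic p ℤ ∣ Q := by
    rw [cyclotomic_eq_minpoly hζ hp.pos]
    exact minpoly.isIntegrallyClosed_dvd (hζ.isIntegral hp.pos) hQ
  have h2 := Polynomial.map_dvd (Int.castRingHom (ZMod p)) h1
  rw [map_cyclotomic] at h2
  have h3 := cyclotomic_mul_prime_eq_pow_of_not_dvd (ZMod p) (p := p) (n := 1)
    (by simpa using hp.one_lt.ne')
  rw [one_mul, cyclotomic_one] at h3
  rwa [h3] at h2

theorem ZMod.exists_sum_pow_mul_X_pow (k : ℕ) (hk : k < p) :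
    ∃ G : (ZMod p)[X], ∑ j ∈ Finset.range p, C ((j : ZMod p) ^ k) * X ^ j =
      (X - 1) ^ (p - 1 - k) * G ∧ G.eval 1 = (-1) ^ k * (k.factorial : ZMod p) := by
  have hp : p.Prime := Fact.out
  induction k with
  | zero =>
    refine ⟨1, ?_, by simp⟩
    have h : (X - 1 : (ZMod p)[X]) * ∑ j ∈ Finset.range p, X ^ j = (X - 1) * (X - 1) ^ (p - 1) := by
      rw [mul_geom_sum, ← pow_succ', Nat.sub_add_cancel hp.one_le, sub_pow_char, one_pow]
    have h' := mul_left_cancel₀ (X_sub_C_ne_zero (1 : ZMod p)) (by simpa using h)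
    simpa using h'
  | succ k ih =>
    obtain ⟨G, hG, hG1⟩ := ih (by omega)
    obtain ⟨n, hn⟩ : ∃ n, p - 1 - k = n + 1 := ⟨p - 2 - k, by omega⟩
    have hn' : p - 1 - (k + 1) = n := by omega
    refine ⟨X * (((n + 1 : ℕ) : (ZMod p)[X]) * G + (X - 1) * derivative G), ?_, ?_⟩
    · have h := congrArg (fun P => X * derivative P) hG
      simp only [derivative_sum] at h
      rw [Finset.mul_sum] at h
      have hl : ∀ j ∈ Finset.range p, X * derivative (C ((j : ZMod p) ^ k) * X ^ j) =
          C ((j : ZMod p) ^ (k + 1)) * X ^ j := by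
        intro j _
        rcases j with _ | j
        · rw [pow_zero, mul_one, derivative_C]
          simp
        · rw [derivative_C_mul_X_pow, Nat.add_sub_cancel, pow_succ _ k, pow_succ _ j]
          ring
      rw [Finset.sum_congr rfl hl] at h
      rw [hn', h, hn, derivative_mul, derivative_pow]
      simp only [derivative_sub, derivative_X, derivative_one, sub_zero, mul_one,
        Nat.add_sub_cancel, map_natCast]
      ring
    · have : ((n + 1 : ℕ) : ZMod p) = -((k + 1 : ℕ) : ZMod p) := by
        rw [eq_neg_iff_add_eq_zero, ← Nat.cast_add, show n + 1 + (k + 1) = p by omega]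
        simp
      simp only [eval_mul, eval_X, eval_add, eval_natCast, eval_sub, eval_one, sub_self, zero_mul,
        add_zero, one_mul, hG1, this]
      push_cast [Nat.factorial_succ]
      ring

variable (p) in
/-- The nonzero squares in `ZMod p`. -/
def quadraticResidues : Finset (ZMod p) :=
  Finset.univ.filter fun c => quadraticChar (ZMod p) c = 1

theorem mem_quadraticResidues {c : ZMod p} :
    c ∈ quadraticResidues p ↔ quadraticChar (ZMod p) c = 1 := by
  simp [quadraticResidues]

theorem card_quadraticResidues (hp2 : p ≠ 2) : (quadraticResidues p).card = p / 2 := by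
  have hp : p.Prime := Fact.out
  have hodd := hp.eq_two_or_odd
  have hchar : ringChar (ZMod p) ≠ 2 := by rwa [ZMod.ringChar_zmod_n]
  have h := quadraticChar_sum_zero (F := ZMod p) hchar
  have h1 : ∑ c : ZMod p, (quadraticChar (ZMod p) c + 1 - if c = 0 then 1 else 0) =
      ∑ c : ZMod p, if quadraticChar (ZMod p) c = 1 then (2 : ℤ) else 0 := by
    refine Finset.sum_congr rfl fun c _ => ?_
    by_cases hc : c = 0
    · simp [hc]
    · rcases quadraticChar_dichotomy hc with h | h <;> simp [h, hc]
  have h2 : ∑ c : ZMod p, (if quadraticChar (ZMod p) c = 1 then (2 : ℤ) else 0) =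
      (quadraticResidues p).card • (2 : ℤ) := by
    rw [← Finset.sum_filter, Finset.sum_const]
    rfl
  rw [Finset.sum_sub_distrib, Finset.sum_add_distrib, h, h2] at h1
  simp [ZMod.card] at h1
  omega

theorem prod_quadraticResidues (hp4 : p % 4 = 1) : ∏ c ∈ quadraticResidues p, c = -1 := by
  have hp : p.Prime := Fact.out
  have hp5 : 5 ≤ p := by
    have := hp.one_lt
    omega
  have hm : (X ^ (p / 2) - 1 : (ZMod p)[X]).Monic := by
    simpa using monic_X_pow_sub_C (1 : ZMod p) (show p / 2 ≠ 0 by omega)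
  have hd : (X ^ (p / 2) - 1 : (ZMod p)[X]).natDegree = p / 2 := by
    simpa using natDegree_X_pow_sub_C (n := p / 2) (r := (1 : ZMod p))
  have hcard := card_quadraticResidues (p := p) (by omega)
  have hroots : (quadraticResidues p).val = (X ^ (p / 2) - 1 : (ZMod p)[X]).roots := by
    refine Multiset.eq_of_le_of_card_le ?_ ?_
    · rw [Finset.val_le_iff_val_subset]
      intro c hc
      rw [Finset.mem_val, mem_quadraticResidues] at hc
      rw [mem_roots hm.ne_zero, IsRoot.def]
      have := quadraticChar_eq_pow_of_char_ne_two' (F := ZMod p)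
        (by rw [ZMod.ringChar_zmod_n]; omega) c
      rw [hc, ZMod.card] at this
      simp [← this]
    · refine (card_roots' _).trans ?_
      rw [hd]
      exact hcard.ge
  have h := prod_multiset_X_sub_C_of_monic_of_roots_card_eq hm (by
    rw [← hroots, hd]; exact hcard)
  rw [← hroots] at h
  have h' := congrArg (eval 0) h
  have h'' : ∏ c ∈ quadraticResidues p, (0 - c) = -1 := by
    have e : eval 0 (Multiset.map (fun a => X - C a) (quadraticResidues p).val).prod =
        ∏ c ∈ quadraticResidues p, (0 - c) := by
      rw [← Finset.prod_eq_multiset_prod, eval_prod]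
      simp
    rw [← e, h']
    simp [show p / 2 ≠ 0 by omega]
  rw [← h'']
  simp only [zero_sub]
  rw [Finset.prod_neg, hcard, Even.neg_one_pow (by rw [Nat.even_iff]; omega), one_mul]

theorem ZMod.sum_range_val {M : Type*} [AddCommMonoid M] (g : ℕ → M) :
    ∑ c : ZMod p, g c.val = ∑ i ∈ Finset.range p, g i := by
  refine Finset.sum_nbij' (fun c => c.val) (fun i => (i : ZMod p)) ?_ (by simp) (by simp)
    ?_ (by simp)
  · intro c _; simpa using ZMod.val_lt c
  · intro i hi; exact ZMod.val_cast_of_lt (Finset.mem_range.1 hi)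

/-- A linear relation over `ℤ[ζ]` between the quadratic Gauss sum and `∏ (1 - ζ ^ r)`, the product
being over the quadratic residues `r`, gives a congruence modulo `p`. -/
theorem eval_one_eq_of_gaussSum_relation (hp4 : p % 4 = 1) {L : Type*} [Field L] [CharZero L]
    {ζ : L} (hζ : IsPrimitiveRoot ζ p) (A B : ℤ[X])
    (h : aeval ζ A * ∑ c : ZMod p, (quadraticChar (ZMod p) c : L) * ζ ^ c.val =
      aeval ζ B * ∏ c ∈ quadraticResidues p, (1 - ζ ^ c.val)) :
    ((A.eval 1 : ℤ) : ZMod p) * ((p / 2).factorial : ZMod p) = -((B.eval 1 : ℤ) : ZMod p) := by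
  have hp : p.Prime := Fact.out
  have hp5 : 5 ≤ p := by
    have := hp.one_lt
    omega
  have hodd := hp.eq_two_or_odd
  have heven : Even (p / 2) := by rw [Nat.even_iff]; omega
  have hQ := X_sub_one_pow_dvd_map_of_aeval_eq_zero hζ
    (Q := A * (∑ c : ZMod p, C (quadraticChar (ZMod p) c) * X ^ c.val) -
      B * ∏ c ∈ quadraticResidues p, (1 - X ^ c.val)) (by
      simp only [map_sub, map_mul, map_sum, map_prod, map_pow, map_one, aeval_X, aeval_C]
      simpa [sub_eq_zero] using h)
  obtain ⟨G, hG, hG1⟩ := ZMod.exists_sum_pow_mul_X_pow (p := p) (p / 2) (by omega)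
  rw [show p - 1 - p / 2 = p / 2 by omega] at hG
  rw [heven.neg_one_pow, one_mul] at hG1
  have h1 : (∑ c : ZMod p, C (quadraticChar (ZMod p) c) * X ^ c.val : ℤ[X]).map
      (Int.castRingHom (ZMod p)) =
      (X - 1) ^ (p / 2) * G := by
    rw [← hG, ← ZMod.sum_range_val, Polynomial.map_sum]
    refine Finset.sum_congr rfl fun c _ => ?_
    have := quadraticChar_eq_pow_of_char_ne_two' (F := ZMod p)
        (by rw [ZMod.ringChar_zmod_n]; omega) c
    rw [ZMod.card] at this
    rw [ZMod.natCast_zmod_val, ← this]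
    simp
  have h2 : (∏ c ∈ quadraticResidues p, (1 - X ^ c.val) : ℤ[X]).map (Int.castRingHom (ZMod p)) =
      (X - 1) ^ (p / 2) * ∏ c ∈ quadraticResidues p, ∑ i ∈ Finset.range c.val, X ^ i := by
    rw [show (X - 1 : (ZMod p)[X]) = -(1 - X) by ring, heven.neg_pow,
      ← card_quadraticResidues (p := p) (by omega), ← Finset.prod_const,
      ← Finset.prod_mul_distrib, Polynomial.map_prod]
    refine Finset.prod_congr rfl fun c _ => ?_
    have := mul_geom_sum (X : (ZMod p)[X]) c.val
    simp only [Polynomial.map_sub, Polynomial.map_one, Polynomial.map_pow, map_X]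
    linear_combination this
  rw [Polynomial.map_sub, Polynomial.map_mul, Polynomial.map_mul, h1, h2, mul_left_comm,
    mul_left_comm (B.map (Int.castRingHom (ZMod p))), ← mul_sub,
    show p - 1 = p / 2 + p / 2 by omega, pow_add] at hQ
  have hX : (X - 1 : (ZMod p)[X]) ≠ 0 := by simpa using X_sub_C_ne_zero (1 : ZMod p)
  obtain ⟨H, hH⟩ := (mul_dvd_mul_iff_left (pow_ne_zero _ hX)).1 hQ
  have hev := congrArg (eval 1) hH
  have hevA : ∀ P : ℤ[X],
      eval 1 (P.map (Int.castRingHom (ZMod p))) = ((P.eval 1 : ℤ) : ZMod p) := by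
    intro P
    rw [← map_one (Int.castRingHom (ZMod p)), eval_map, eval₂_hom]
    rfl
  have hprod : ∏ c ∈ quadraticResidues p, (c.val : ZMod p) = -1 := by
    simp only [ZMod.natCast_zmod_val]
    exact prod_quadraticResidues hp4
  simp only [eval_sub, eval_mul, hevA, hG1, eval_prod,
    Polynomial.eval_finsetSum, eval_pow, eval_X, one_pow,
    Finset.sum_const, Finset.card_range, eval_one, sub_self, zero_mul, nsmul_eq_mul, mul_one,
    hprod, zero_pow (show p / 2 ≠ 0 by omega)] at hev
  linear_combination hev

theorem natCast_pow_eq_of_unit_relation (hp4 : p % 4 = 1) {L : Type*} [Field L] [CharZero L]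
    {ζ : L} (hζ : IsPrimitiveRoot ζ p) {s e : L} (he : e = 1 ∨ e = -1) (t u h : ℕ)
    (hτ : ∑ c : ZMod p, (quadraticChar (ZMod p) c : L) * ζ ^ c.val = e * s)
    (hrel : (e = 1 ∧ ((t + u * s) / 2) ^ h * ∏ c ∈ quadraticResidues p, (1 - ζ ^ c.val) = s) ∨
      (e = -1 ∧ ∏ c ∈ quadraticResidues p, (1 - ζ ^ c.val) = s * ((t + u * s) / 2) ^ h)) :
    (t : ZMod p) ^ h = -2 ^ h * ((p / 2).factorial : ZMod p) := by
  have hp : p.Prime := Fact.out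
  set T : ℤ[X] := ∑ c : ZMod p, C (quadraticChar (ZMod p) c) * X ^ c.val with hT
  have hTζ : aeval ζ T = e * s := by
    rw [← hτ, hT]
    simp
  have hT1 : T.eval 1 = 0 := by
    rw [hT, Polynomial.eval_finsetSum]
    simpa using quadraticChar_sum_zero (F := ZMod p) (by rw [ZMod.ringChar_zmod_n]; omega)
  have h2 : (2 : L) ^ h ≠ 0 := pow_ne_zero _ two_ne_zero
  rcases hrel with ⟨rfl, hrel⟩ | ⟨rfl, hrel⟩
  · have := eval_one_eq_of_gaussSum_relation hp4 hζ (2 ^ h) (((t : ℤ[X]) + u * T) ^ h) (by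
      rw [hτ]
      simp only [map_pow, map_add, map_mul, map_natCast, map_ofNat, hTζ, one_mul]
      rw [div_pow] at hrel
      field_simp at hrel
      linear_combination -hrel)
    simp [hT1] at this
    linear_combination this
  · have := eval_one_eq_of_gaussSum_relation hp4 hζ (-(((t : ℤ[X]) - u * T) ^ h)) (2 ^ h) (by
      rw [hτ, hrel]
      simp only [map_neg, map_pow, map_sub, map_mul, map_natCast, map_ofNat, hTζ]
      rw [div_pow]
      field_simp
      ring)
    simp [hT1] at this
    have hs := ZMod.natCast_factorial_half_sq (p := p) hp4
    linear_combination -((p / 2).factorial : ZMod p) * this + (t : ZMod p) ^ h * hs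

end CyclotomicCongruence

section LSeriesAtOne

open Complex Filter Topology MeasureTheory Set

theorem Complex.re_lt_one_of_norm_eq_one {z : ℂ} (hz : ‖z‖ = 1) (hz1 : z ≠ 1) : z.re < 1 := by
  refine lt_of_le_of_ne (hz ▸ z.re_le_norm) fun h => hz1 ?_
  have h2 := Complex.sq_norm z
  rw [hz, Complex.normSq_apply, h] at h2
  refine Complex.ext h ?_
  rw [Complex.one_im]
  nlinarith

theorem Complex.one_sub_mul_exp_neg_mem_slitPlane {z : ℂ} (hz : ‖z‖ = 1) (hz1 : z ≠ 1) {x : ℝ}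
    (hx : 0 ≤ x) : 1 - z * (Real.exp (-x) : ℂ) ∈ slitPlane := by
  left
  rw [Complex.sub_re, Complex.one_re, Complex.re_mul_ofReal]
  have h1 := Complex.re_lt_one_of_norm_eq_one hz hz1
  have h2 : Real.exp (-x) ≤ 1 := Real.exp_le_one_iff.2 (by linarith)
  have h3 := Real.exp_pos (-x)
  nlinarith

/-- The Lambert-type kernel whose Mellin transform at `s` is `Γ(s) ∑ z ^ n / n ^ s`. -/
noncomputable def polylogKernel (z : ℂ) (x : ℝ) : ℂ :=
  z * (Real.exp (-x) : ℂ) / (1 - z * (Real.exp (-x) : ℂ))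

theorem continuousOn_polylogKernel {z : ℂ} (hz : ‖z‖ = 1) (hz1 : z ≠ 1) :
    ContinuousOn (polylogKernel z) (Ici 0) := by
  unfold polylogKernel
  refine ContinuousOn.div (by fun_prop) (by fun_prop) fun x hx => ?_
  exact slitPlane_ne_zero (one_sub_mul_exp_neg_mem_slitPlane hz hz1 hx)

theorem hasSum_polylogKernel {z : ℂ} (hz : ‖z‖ = 1) {x : ℝ} (hx : 0 < x) :
    HasSum (fun n : ℕ => z ^ (n + 1) * (Real.exp (-((n + 1 : ℕ) : ℝ) * x) : ℂ))
      (polylogKernel z x) := by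
  have h : ‖z * (Real.exp (-x) : ℂ)‖ < 1 := by
    rw [norm_mul, hz, one_mul, Complex.norm_real, Real.norm_of_nonneg (Real.exp_pos _).le]
    exact Real.exp_lt_one_iff.2 (by linarith)
  have h2 := (hasSum_geometric_of_norm_lt_one h).mul_left (z * (Real.exp (-x) : ℂ))
  rw [← div_eq_mul_inv] at h2
  refine h2.congr_fun fun n => ?_
  rw [← pow_succ', mul_pow, ← Complex.ofReal_pow, ← Real.exp_nat_mul]
  congr 3
  ring

theorem Complex.tendsto_ofReal_exp_neg_atTop :
    Tendsto (fun x : ℝ => (Real.exp (-x) : ℂ)) atTop (𝓝 0) :=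
  (Complex.continuous_ofReal.tendsto' 0 0 Complex.ofReal_zero).comp
    (Real.tendsto_exp_atBot.comp tendsto_neg_atTop_atBot)

theorem isBigO_polylogKernel_atTop (z : ℂ) :
    polylogKernel z =O[atTop] fun x => Real.exp (-1 * x) := by
  have h : Tendsto (fun x : ℝ => z / (1 - z * (Real.exp (-x) : ℂ))) atTop
      (𝓝 (z / (1 - z * 0))) := by
    exact Tendsto.div tendsto_const_nhds (tendsto_const_nhds.sub
      (tendsto_const_nhds.mul Complex.tendsto_ofReal_exp_neg_atTop)) (by simp)
  have h2 := (h.isBigO_one ℝ).mul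
    (Asymptotics.isBigO_of_le atTop (f := fun x : ℝ => (Real.exp (-x) : ℂ))
      (g := fun x : ℝ => Real.exp (-1 * x)) fun x => by
        rw [Complex.norm_real, neg_one_mul])
  refine (h2.congr_left fun x => ?_).congr_right fun x => ?_
  · simp only [polylogKernel]
    ring
  · simp

theorem isBigO_polylogKernel_zero {z : ℂ} (hz : ‖z‖ = 1) (hz1 : z ≠ 1) :
    polylogKernel z =O[𝓝[>] 0] fun x => x ^ (-(0 : ℝ)) := by
  simp only [neg_zero, Real.rpow_zero]
  exact (((continuousOn_polylogKernel hz hz1) 0 self_mem_Ici).mono Ioi_subset_Ici_self).isBigO_one ℝ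

theorem mellin_polylogKernel_one {z : ℂ} (hz : ‖z‖ = 1) (hz1 : z ≠ 1) :
    mellin (polylogKernel z) 1 = -log (1 - z) := by
  have hint : MellinConvergent (polylogKernel z) 1 :=
    mellinConvergent_of_isBigO_rpow_exp one_pos
      (((continuousOn_polylogKernel hz hz1).mono Ioi_subset_Ici_self).locallyIntegrableOn
        measurableSet_Ioi) (isBigO_polylogKernel_atTop z) (isBigO_polylogKernel_zero hz hz1)
      (by simp)
  have hd : ∀ x ∈ Ici (0 : ℝ), HasDerivAt (fun x : ℝ => log (1 - z * (Real.exp (-x) : ℂ)))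
      (polylogKernel z x) x := by
    intro x hx
    have h1 : HasDerivAt (fun x : ℝ => (Real.exp (-x) : ℂ)) ((-Real.exp (-x) : ℝ) : ℂ) x := by
      have := ((Real.hasDerivAt_exp (-x)).comp x (hasDerivAt_neg x)).ofReal_comp
      simpa using! this
    have h2 := ((h1.const_mul z).const_sub 1).clog_real
      (one_sub_mul_exp_neg_mem_slitPlane hz hz1 hx)
    refine h2.congr_deriv ?_
    simp [polylogKernel]
  have hint' : IntegrableOn (polylogKernel z) (Ioi 0) := by
    simpa [MellinConvergent] using hint
  have hlim : Tendsto (fun x : ℝ => log (1 - z * (Real.exp (-x) : ℂ))) atTop (𝓝 0) := by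
    have h1 : Tendsto (fun x : ℝ => 1 - z * (Real.exp (-x) : ℂ)) atTop (𝓝 (1 - z * 0)) :=
      tendsto_const_nhds.sub (tendsto_const_nhds.mul Complex.tendsto_ofReal_exp_neg_atTop)
    have h2 := (continuousAt_clog (x := 1 - z * 0) (by simp)).tendsto.comp h1
    simpa using! h2
  have := integral_Ioi_of_hasDerivAt_of_tendsto (hd 0 self_mem_Ici).continuousAt.continuousWithinAt
    (fun x hx => hd x (Ioi_subset_Ici_self hx)) hint' hlim
  simpa [mellin] using this

theorem mellin_polylogKernel {z : ℂ} (hz : ‖z‖ = 1) {s : ℂ} (hs : 1 < s.re) :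
    mellin (polylogKernel z) s = Gamma s * LSeries (fun n => z ^ n) s := by
  have hsum : Summable fun n : ℕ => ‖z ^ (n + 1)‖ / (((n + 1 : ℕ) : ℝ)) ^ s.re := by
    simp only [norm_pow, hz, one_pow]
    exact (summable_nat_add_iff 1).2 (Real.summable_one_div_nat_rpow.2 hs)
  have h := hasSum_mellin (s := s) (a := fun n : ℕ => z ^ (n + 1))
    (p := fun n : ℕ => ((n + 1 : ℕ) : ℝ)) (F := polylogKernel z)
    (fun i => Or.inr (by positivity)) (by linarith)
    (fun t ht => hasSum_polylogKernel hz ht) hsum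
  rw [← h.tsum_eq]
  have hL : LSeriesSummable (fun n => z ^ n) s :=
    LSeriesSummable_of_bounded_of_one_lt_re (m := 1) (fun n _ => by simp [hz]) hs
  rw [LSeries, hL.tsum_eq_zero_add, LSeries.term_zero, zero_add, ← tsum_mul_left]
  refine tsum_congr fun n => ?_
  rw [LSeries.term_of_ne_zero n.succ_ne_zero, mul_div_assoc]
  simp

theorem tendsto_LSeries_pow {z : ℂ} (hz : ‖z‖ = 1) (hz1 : z ≠ 1) :
    Tendsto (fun s : ℝ => LSeries (fun n => z ^ n) s) (𝓝[>] 1) (𝓝 (-log (1 - z))) := by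
  have hd : DifferentiableAt ℂ (mellin (polylogKernel z)) 1 :=
    mellin_differentiableAt_of_isBigO_rpow_exp one_pos
      (((continuousOn_polylogKernel hz hz1).mono Ioi_subset_Ici_self).locallyIntegrableOn
        measurableSet_Ioi) (isBigO_polylogKernel_atTop z) (isBigO_polylogKernel_zero hz hz1)
      (by simp)
  have hG : ContinuousAt Gamma 1 := (differentiableAt_Gamma_one).continuousAt
  have h1 : Tendsto (fun s : ℂ => mellin (polylogKernel z) s / Gamma s) (𝓝 1)
      (𝓝 (mellin (polylogKernel z) 1 / Gamma 1)) :=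
    hd.continuousAt.tendsto.div hG.tendsto (by simp)
  rw [mellin_polylogKernel_one hz hz1, Gamma_one, div_one] at h1
  have h2 : Tendsto (fun s : ℝ => (s : ℂ)) (𝓝[>] 1) (𝓝 1) :=
    (Complex.continuous_ofReal.tendsto' 1 1 (by simp)).mono_left nhdsWithin_le_nhds
  refine (h1.comp h2).congr' ?_
  filter_upwards [self_mem_nhdsWithin] with s hs
  have hs' : 1 < (s : ℂ).re := by simpa using hs
  rw [Function.comp_apply, mellin_polylogKernel hz hs', mul_div_cancel_left₀]
  exact Gamma_ne_zero_of_re_pos (by linarith)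

variable {p : ℕ} [Fact p.Prime]

variable (p) in
/-- The quadratic character modulo `p`, with complex values. -/
noncomputable def complexQuadraticChar : DirichletCharacter ℂ p :=
  (quadraticChar (ZMod p)).ringHomComp (Int.castRingHom ℂ)

theorem complexQuadraticChar_apply (c : ZMod p) :
    complexQuadraticChar p c = (quadraticChar (ZMod p) c : ℂ) := by
  simp [complexQuadraticChar]

theorem complexQuadraticChar_isQuadratic : (complexQuadraticChar p).IsQuadratic :=
  (quadraticChar_isQuadratic (ZMod p)).comp _

theorem complexQuadraticChar_ne_one (hp2 : p ≠ 2) : complexQuadraticChar p ≠ 1 := by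
  have hchar : ringChar (ZMod p) ≠ 2 := by rwa [ZMod.ringChar_zmod_n]
  exact (MulChar.ringHomComp_ne_one_iff Int.cast_injective).2 (quadraticChar_ne_one hchar)

theorem gaussSum_complexQuadraticChar {ζ : ℂ} (hζ : ζ ^ p = 1) :
    gaussSum (complexQuadraticChar p) (AddChar.zmodChar p hζ) =
      ∑ c : ZMod p, (quadraticChar (ZMod p) c : ℂ) * ζ ^ c.val := by
  simp [gaussSum, complexQuadraticChar_apply, AddChar.zmodChar_apply]

theorem sum_quadraticChar_mul_pow_mul (hp2 : p ≠ 2) {ζ : ℂ} (hζ : ζ ^ p = 1) (n : ℕ) :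
    ∑ c : ZMod p, (quadraticChar (ZMod p) c : ℂ) * (ζ ^ c.val) ^ n =
      (quadraticChar (ZMod p) n : ℂ) *
        ∑ c : ZMod p, (quadraticChar (ZMod p) c : ℂ) * ζ ^ c.val := by
  have hl : ∑ c : ZMod p, (quadraticChar (ZMod p) c : ℂ) * (ζ ^ c.val) ^ n =
      gaussSum (complexQuadraticChar p) ((AddChar.zmodChar p hζ).mulShift n) := by
    simp only [gaussSum, complexQuadraticChar_apply, AddChar.mulShift_apply]
    refine Finset.sum_congr rfl fun c _ => ?_
    rw [← nsmul_eq_mul, AddChar.map_nsmul_eq_pow, AddChar.zmodChar_apply]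
  rw [hl, ← gaussSum_complexQuadraticChar hζ]
  by_cases hn : (n : ZMod p) = 0
  · rw [hn, AddChar.mulShift_zero, gaussSum_one_right (complexQuadraticChar_ne_one hp2)]
    simp
  · have h := gaussSum_mulShift (complexQuadraticChar p) (AddChar.zmodChar p hζ) (Units.mk0 _ hn)
    rw [Units.val_mk0, complexQuadraticChar_apply] at h
    rw [← h, ← mul_assoc, ← sq, ← Int.cast_pow, quadraticChar_sq_one hn, Int.cast_one, one_mul]

theorem sq_sum_quadraticChar_mul_pow (hp4 : p % 4 = 1) {ζ : ℂ} (hζ : IsPrimitiveRoot ζ p) :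
    (∑ c : ZMod p, (quadraticChar (ZMod p) c : ℂ) * ζ ^ c.val) ^ 2 = p := by
  rw [← gaussSum_complexQuadraticChar hζ.pow_eq_one,
    gaussSum_sq (χ := complexQuadraticChar p) (complexQuadraticChar_ne_one (by rintro rfl; omega))
      complexQuadraticChar_isQuadratic (AddChar.zmodChar_primitive_of_primitive_root p hζ),
    ZMod.card, complexQuadraticChar_apply,
    (quadraticChar_one_iff_isSquare (by simp)).2 (ZMod.exists_sq_eq_neg_one_iff.2 (by omega))]
  simp

theorem tendsto_gaussSum_mul_LSeries (hp2 : p ≠ 2) {ζ : ℂ} (hζ : IsPrimitiveRoot ζ p) :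
    Tendsto (fun s : ℝ => (∑ c : ZMod p, (quadraticChar (ZMod p) c : ℂ) * ζ ^ c.val) *
        LSeries (fun n => complexQuadraticChar p n) s) (𝓝[>] 1)
      (𝓝 (-∑ c : ZMod p, (quadraticChar (ZMod p) c : ℂ) * log (1 - ζ ^ c.val))) := by
  have hp : p.Prime := Fact.out
  have h1 : Tendsto (fun s : ℝ => ∑ c : ZMod p, (quadraticChar (ZMod p) c : ℂ) *
      LSeries (fun n => (ζ ^ c.val) ^ n) s) (𝓝[>] 1)
      (𝓝 (∑ c : ZMod p, (quadraticChar (ZMod p) c : ℂ) * -log (1 - ζ ^ c.val))) := by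
    refine tendsto_finsetSum _ fun c _ => ?_
    by_cases hc : c = 0
    · simp [hc]
    · refine (tendsto_LSeries_pow ?_ ?_).const_mul _
      · rw [norm_pow, hζ.norm'_eq_one hp.ne_zero, one_pow]
      · exact hζ.pow_ne_one_of_pos_of_lt (by simpa using hc) (ZMod.val_lt c)
  simp only [mul_neg, Finset.sum_neg_distrib] at h1
  refine h1.congr' ?_
  filter_upwards [self_mem_nhdsWithin] with s hs
  have hs' : 1 < (s : ℂ).re := by simpa using hs
  simp only [← LSeries_smul]
  rw [← LSeries_sum]
  · refine LSeries_congr (fun {n} _ => ?_) _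
    simp only [Finset.sum_apply, Pi.smul_apply, smul_eq_mul]
    rw [sum_quadraticChar_mul_pow_mul hp2 hζ.pow_eq_one, complexQuadraticChar_apply, mul_comm]
  · intro c _
    refine (LSeriesSummable_of_bounded_of_one_lt_re (m := 1) (fun n _ => ?_) hs').smul _
    simp [hζ.norm'_eq_one hp.ne_zero]

end LSeriesAtOne

section IdealCount

open Ideal

variable {K : Type*} [Field K] [NumberField K]

variable (K) in
/-- The number of ideals of norm `n` in the ring of integers of `K`. -/
noncomputable def idealCount (n : ℕ) : ℕ := Nat.card {I : Ideal (𝓞 K) // absNorm I = n}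

theorem sup_span_natCast_eq_top_of_coprime {I : Ideal (𝓞 K)} {m n : ℕ} (hmn : m.Coprime n)
    (hI : absNorm I = m) : I ⊔ span {(n : 𝓞 K)} = ⊤ := by
  rw [Ideal.eq_top_iff_one]
  have hm : (m : 𝓞 K) ∈ I := hI ▸ absNorm_mem I
  have h := Nat.isCoprime_iff_coprime.2 hmn
  obtain ⟨a, b, hab⟩ := h
  have : (1 : 𝓞 K) = a * m + b * n := by exact_mod_cast hab.symm
  rw [this]
  exact add_mem (mul_mem_left _ _ (mem_sup_left hm))
    (mul_mem_left _ _ (mem_sup_right (mem_span_singleton_self _)))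

theorem mul_sup_span_natCast_eq {I J : Ideal (𝓞 K)} {m n : ℕ} (hmn : m.Coprime n)
    (hI : absNorm I = m) (hJ : absNorm J = n) : I * J ⊔ span {(m : 𝓞 K)} = I := by
  have hm : span {(m : 𝓞 K)} ≤ I := by
    rw [span_singleton_le_iff_mem]
    exact hI ▸ absNorm_mem I
  refine le_antisymm (sup_le mul_le_left hm) ?_
  calc I = I * (J ⊔ span {(m : 𝓞 K)}) := by
        rw [sup_span_natCast_eq_top_of_coprime hmn.symm hJ, mul_top]
    _ = I * J ⊔ I * span {(m : 𝓞 K)} := Ideal.mul_sup _ _ _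
    _ ≤ I * J ⊔ span {(m : 𝓞 K)} := sup_le_sup_left mul_le_right _

theorem sup_mul_sup_eq {I : Ideal (𝓞 K)} {m n : ℕ} (hmn : m.Coprime n)
    (hI : absNorm I = m * n) : (I ⊔ span {(m : 𝓞 K)}) * (I ⊔ span {(n : 𝓞 K)}) = I := by
  have h1 : span {(m : 𝓞 K)} ⊔ span {(n : 𝓞 K)} = ⊤ := by
    rw [Ideal.eq_top_iff_one]
    obtain ⟨a, b, hab⟩ := Nat.isCoprime_iff_coprime.2 hmn
    have : (1 : 𝓞 K) = a * m + b * n := by exact_mod_cast hab.symm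
    rw [this]
    exact add_mem (mul_mem_left _ _ (mem_sup_left (mem_span_singleton_self _)))
      (mul_mem_left _ _ (mem_sup_right (mem_span_singleton_self _)))
  have h2 : span {(m : 𝓞 K)} * span {(n : 𝓞 K)} ≤ I := by
    rw [span_singleton_mul_span_singleton, span_singleton_le_iff_mem]
    have := absNorm_mem I
    rw [hI] at this
    exact_mod_cast this
  refine le_antisymm ?_ ?_
  · rw [Ideal.sup_mul, Ideal.mul_sup, Ideal.mul_sup]
    exact sup_le (sup_le mul_le_left mul_le_left) (sup_le mul_le_right h2)
  · calc I = I * (span {(m : 𝓞 K)} ⊔ span {(n : 𝓞 K)}) := by rw [h1, mul_top]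
      _ = span {(m : 𝓞 K)} * I ⊔ I * span {(n : 𝓞 K)} := by rw [Ideal.mul_sup, mul_comm I]
      _ ≤ _ := sup_le (mul_mono le_sup_right le_sup_left) (mul_mono le_sup_left le_sup_right)

theorem idealCount_mul_of_coprime {m n : ℕ} (hmn : m.Coprime n) :
    idealCount K (m * n) = idealCount K m * idealCount K n := by
  rw [idealCount, idealCount, idealCount, ← Nat.card_prod]
  symm
  refine Nat.card_congr (Equiv.ofBijective
    (fun x => ⟨x.1.1 * x.2.1, by rw [map_mul, x.1.2, x.2.2]⟩) ⟨?_, ?_⟩)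
  · rintro ⟨⟨I, hI⟩, J, hJ⟩ ⟨⟨I', hI'⟩, J', hJ'⟩ h
    have h' : I * J = I' * J' := congrArg Subtype.val h
    have e1 : I = I' := by
      rw [← mul_sup_span_natCast_eq hmn hI hJ, h', mul_sup_span_natCast_eq hmn hI' hJ']
    have e2 : J = J' := by
      rw [← mul_sup_span_natCast_eq hmn.symm hJ hI, mul_comm, h', mul_comm,
        mul_sup_span_natCast_eq hmn.symm hJ' hI']
    subst e1 e2
    rfl
  · rintro ⟨I, hI⟩
    have hprod := sup_mul_sup_eq hmn hI
    set A := I ⊔ span {(m : 𝓞 K)} with hA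
    set B := I ⊔ span {(n : 𝓞 K)} with hB
    have hN : absNorm A * absNorm B = m * n := by rw [← map_mul, hprod, hI]
    have key : ∀ (k : ℕ), absNorm (I ⊔ span {(k : 𝓞 K)}) ∣ k ^ Module.finrank ℚ K := by
      intro k
      have := absNorm_dvd_absNorm_of_le (le_sup_right : span {(k : 𝓞 K)} ≤ I ⊔ span {(k : 𝓞 K)})
      rwa [absNorm_span_natCast, RingOfIntegers.rank] at this
    have hAm : absNorm A ∣ m :=
      ((hmn.pow_left _).coprime_dvd_left (key m)).dvd_of_dvd_mul_right (hN ▸ dvd_mul_right _ _)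
    have hBn : absNorm B ∣ n :=
      ((hmn.symm.pow_left _).coprime_dvd_left (key n)).dvd_of_dvd_mul_left (hN ▸ dvd_mul_left _ _)
    have hmA : m ∣ absNorm A :=
      (hmn.coprime_dvd_right hBn).dvd_of_dvd_mul_right (hN ▸ dvd_mul_right _ _)
    have hnB : n ∣ absNorm B :=
      (hmn.symm.coprime_dvd_right hAm).dvd_of_dvd_mul_left (hN ▸ dvd_mul_left _ _)
    exact ⟨⟨⟨A, Nat.dvd_antisymm hAm hmA⟩, ⟨B, Nat.dvd_antisymm hBn hnB⟩⟩, Subtype.ext hprod⟩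

/-- Ideals of norm a power of `q`, when all primes containing `q` are among `P₁`, `P₂`. -/
theorem exists_pow_mul_pow_of_absNorm_eq_pow {q : ℕ} (hq : q.Prime) {P₁ P₂ : Ideal (𝓞 K)}
    (hP : ∀ P : Ideal (𝓞 K), P.IsPrime → (q : 𝓞 K) ∈ P → P = P₁ ∨ P = P₂) (k : ℕ)
    (I : Ideal (𝓞 K)) (hI : absNorm I = q ^ k) : ∃ i j, I = P₁ ^ i * P₂ ^ j := by
  induction k using Nat.strong_induction_on generalizing I with
  | _ k ih =>
  by_cases htop : I = ⊤
  · exact ⟨0, 0, by simp [htop]⟩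
  obtain ⟨P, hPmax, hIP⟩ := exists_le_maximal I htop
  have hqP : (q : 𝓞 K) ∈ P := by
    have := hIP (absNorm_mem I)
    rw [hI, Nat.cast_pow] at this
    exact hPmax.isPrime.mem_of_pow_mem _ this
  obtain ⟨J, rfl⟩ := dvd_iff_le.2 hIP
  rw [map_mul] at hI
  obtain ⟨l, hl, hJ⟩ := (Nat.dvd_prime_pow hq).1 (hI ▸ dvd_mul_left (absNorm J) (absNorm P))
  have hP1 : absNorm P ≠ 1 := by
    rw [Ne, absNorm_eq_one_iff]
    exact hPmax.ne_top
  have hlk : l ≠ k := by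
    rintro rfl
    rw [hJ] at hI
    exact hP1 (Nat.eq_of_mul_eq_mul_right (pow_pos hq.pos l) (by rw [hI, one_mul]))
  obtain ⟨i, j, rfl⟩ := ih l (lt_of_le_of_ne hl hlk) J hJ
  rcases hP P hPmax.isPrime hqP with rfl | rfl
  · exact ⟨i + 1, j, by ring⟩
  · exact ⟨i, j + 1, by ring⟩

theorem idealCount_prime_pow_of_split {q : ℕ} (hq : q.Prime) {P₁ P₂ : Ideal (𝓞 K)}
    (hP : ∀ P : Ideal (𝓞 K), P.IsPrime → (q : 𝓞 K) ∈ P → P = P₁ ∨ P = P₂)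
    (h1 : absNorm P₁ = q) (h2 : absNorm P₂ = q) (hne : P₁ ≠ P₂) (k : ℕ) :
    idealCount K (q ^ k) = k + 1 := by
  have hprime : ∀ P : Ideal (𝓞 K), absNorm P = q → P.IsPrime := fun P h =>
    isPrime_of_irreducible_absNorm (h ▸ hq)
  have h10 : ∀ P : Ideal (𝓞 K), absNorm P = q → P ≠ ⊥ := by
    rintro P h rfl
    exact hq.ne_zero (by simpa using h.symm)
  have hnd : ∀ n, ¬ P₁ ∣ P₂ ^ n := by
    intro n h
    have hp := (hprime P₁ h1).isMaximal (h10 _ h1)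
    have := (hprime P₁ h1).le_of_pow_le (dvd_iff_le.1 h)
    exact hne ((((hprime P₂ h2).isMaximal (h10 _ h2)).eq_of_le hp.ne_top this).symm)
  rw [← Finset.Nat.card_antidiagonal k, ← Nat.card_eq_finsetCard, idealCount]
  symm
  refine Nat.card_congr (Equiv.ofBijective
    (fun x => ⟨P₁ ^ x.1.1 * P₂ ^ x.1.2, by
      rw [map_mul, map_pow, map_pow, h1, h2, ← pow_add,
        Finset.HasAntidiagonal.mem_antidiagonal.1 x.2]⟩) ⟨?_, ?_⟩)
  · have key : ∀ i j i' j', P₁ ^ i * P₂ ^ j = P₁ ^ i' * P₂ ^ j' → ¬ i < i' := by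
      intro i j i' j' h hlt
      obtain ⟨d, rfl⟩ := Nat.exists_eq_add_of_lt hlt
      rw [add_assoc, pow_add, mul_assoc] at h
      have h' := mul_left_cancel₀ (pow_ne_zero i (h10 _ h1)) h
      exact hnd j ⟨P₁ ^ d * P₂ ^ j', by rw [h', pow_succ]; ring⟩
    rintro ⟨⟨i, j⟩, hij⟩ ⟨⟨i', j'⟩, hij'⟩ h
    have h' : P₁ ^ i * P₂ ^ j = P₁ ^ i' * P₂ ^ j' := congrArg Subtype.val h
    have a := key _ _ _ _ h'
    have b := key _ _ _ _ h'.symm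
    rw [Finset.HasAntidiagonal.mem_antidiagonal] at hij hij'
    simp only at hij hij'
    ext
    simp
    omega
  · rintro ⟨I, hI⟩
    obtain ⟨i, j, rfl⟩ := exists_pow_mul_pow_of_absNorm_eq_pow hq hP k I hI
    refine ⟨⟨(i, j), ?_⟩, rfl⟩
    rw [map_mul, map_pow, map_pow, h1, h2, ← pow_add] at hI
    rw [Finset.HasAntidiagonal.mem_antidiagonal]
    exact Nat.pow_right_injective hq.two_le hI

theorem idealCount_prime_pow_of_unique {q : ℕ} (hq : q.Prime) {P : Ideal (𝓞 K)} {d : ℕ}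
    (hd : d ≠ 0)
    (hP : ∀ Q : Ideal (𝓞 K), Q.IsPrime → (q : 𝓞 K) ∈ Q → Q = P)
    (hPq : absNorm P = q ^ d) (k : ℕ) :
    idealCount K (q ^ k) = if d ∣ k then 1 else 0 := by
  have hsol : ∀ I : Ideal (𝓞 K), absNorm I = q ^ k → ∃ i, I = P ^ i ∧ k = d * i := by
    intro I hI
    obtain ⟨i, j, rfl⟩ := exists_pow_mul_pow_of_absNorm_eq_pow hq
      (fun Q h h' => Or.inl (hP Q h h') : ∀ Q : Ideal (𝓞 K), Q.IsPrime → (q : 𝓞 K) ∈ Q →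
        Q = P ∨ Q = P) k I hI
    refine ⟨i + j, (pow_add _ _ _).symm, ?_⟩
    rw [← pow_add, map_pow, hPq, ← pow_mul] at hI
    exact (Nat.pow_right_injective hq.two_le hI).symm
  rw [idealCount]
  split_ifs with h
  · obtain ⟨i, rfl⟩ := h
    rw [Nat.card_eq_one_iff_unique]
    refine ⟨⟨?_⟩, ⟨⟨P ^ i, by rw [map_pow, hPq, pow_mul]⟩⟩⟩
    rintro ⟨I, hI⟩ ⟨J, hJ⟩
    obtain ⟨a, rfl, ha⟩ := hsol I hI
    obtain ⟨b, rfl, hb⟩ := hsol J hJ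
    have : a = b := Nat.eq_of_mul_eq_mul_left (Nat.pos_of_ne_zero hd) (ha.symm.trans hb)
    subst this
    rfl
  · rw [Nat.card_eq_zero]
    left
    refine ⟨?_⟩
    rintro ⟨I, hI⟩
    obtain ⟨i, -, rfl⟩ := hsol I hI
    exact h (dvd_mul_right _ _)

end IdealCount

section QuadraticField

open Polynomial

variable {p : ℕ} {K : Type*} [Field K] [NumberField K] {α : K}

theorem minpoly_eq_of_sq_eq_prime (hp : p.Prime) (hα : α ^ 2 = p) :
    minpoly ℚ α = X ^ 2 - C (p : ℚ) := by
  symm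
  refine minpoly.eq_of_irreducible_of_monic ?_ (by simp [hα]) (monic_X_pow_sub_C _ two_ne_zero)
  refine X_pow_sub_C_irreducible_of_prime Nat.prime_two fun b hb => ?_
  have : IsSquare (p : ℚ) := ⟨b, by rw [← hb, sq]⟩
  rw [Rat.isSquare_natCast_iff] at this
  exact hp.prime.not_isSquare this

theorem finrank_eq_two_of_sq_eq_prime (hp : p.Prime) (hα : α ^ 2 = p)
    (hgen : Algebra.adjoin ℚ {α} = ⊤) : Module.finrank ℚ K = 2 := by
  have hint : IsIntegral ℚ α := Algebra.IsIntegral.isIntegral α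
  rw [(PowerBasis.ofAdjoinEqTop hint hgen).finrank, PowerBasis.ofAdjoinEqTop_dim,
    minpoly_eq_of_sq_eq_prime hp hα, natDegree_X_pow_sub_C]

theorem exists_eq_add_mul_of_adjoin_eq_top (hα : α ^ 2 = p) (hgen : Algebra.adjoin ℚ {α} = ⊤)
    (x : K) : ∃ r s : ℚ, x = r + s * α := by
  have hx : x ∈ Algebra.adjoin ℚ {α} := hgen ▸ Algebra.mem_top
  induction hx using Algebra.adjoin_induction with
  | mem x hx => exact ⟨0, 1, by rw [Set.mem_singleton_iff.1 hx]; simp⟩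
  | algebraMap r => exact ⟨r, 0, by simp⟩
  | add x y _ _ hx hy =>
    obtain ⟨r, s, rfl⟩ := hx
    obtain ⟨r', s', rfl⟩ := hy
    exact ⟨r + r', s + s', by push_cast; ring⟩
  | mul x y _ _ hx hy =>
    obtain ⟨r, s, rfl⟩ := hx
    obtain ⟨r', s', rfl⟩ := hy
    exact ⟨r * r' + s * s' * p, r * s' + r' * s, by
      push_cast; linear_combination (s * s' : K) * hα⟩

theorem trace_rat_add_mul (hp : p.Prime) (hα : α ^ 2 = p) (hgen : Algebra.adjoin ℚ {α} = ⊤)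
    (r s : ℚ) : Algebra.trace ℚ K (r + s * α) = 2 * r := by
  have h2 := finrank_eq_two_of_sq_eq_prime hp hα hgen
  have h0 : Algebra.trace ℚ K α = 0 := by
    rw [trace_eq_finrank_mul_minpoly_nextCoeff, minpoly_eq_of_sq_eq_prime hp hα, nextCoeff,
      natDegree_X_pow_sub_C]
    simp [coeff_X_pow]
  have h1 : (r + s * α : K) = algebraMap ℚ K r + s • α := by
    rw [Algebra.smul_def]; simp
  rw [h1, map_add, map_smul, h0, Algebra.trace_algebraMap, h2]
  simp

theorem rat_add_mul_eq_zero (hp : p.Prime) (hα : α ^ 2 = p) (hgen : Algebra.adjoin ℚ {α} = ⊤)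
    {r s : ℚ} (h : (r + s * α : K) = 0) : r = 0 ∧ s = 0 := by
  have h1 := trace_rat_add_mul hp hα hgen r s
  have h2 := trace_rat_add_mul hp hα hgen (s * p) r
  rw [h, map_zero] at h1
  have h3 : (((s * p : ℚ) : K) + r * α) = 0 := by
    push_cast
    linear_combination α * h - (s : K) * hα
  rw [h3, map_zero] at h2
  have hp0 : (p : ℚ) ≠ 0 := by exact_mod_cast hp.ne_zero
  refine ⟨by linarith, ?_⟩
  have : s * p = 0 := by linarith
  exact (mul_eq_zero.1 this).resolve_right hp0

/-- The integer `(1 + √p) / 2`, as a root of `X² - X - m` where `p = 4 m + 1`. -/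
theorem exists_integer_sq_eq {m : ℕ} (hα : α ^ 2 = p) (hm : p = 4 * m + 1) :
    ∃ ω : 𝓞 K, (2 * ω - 1 : K) = α ∧ ω ^ 2 = ω + m := by
  have hsq : ((1 + α) / 2) ^ 2 = (1 + α) / 2 + m := by
    rw [hm] at hα
    push_cast at hα
    linear_combination hα / 4
  have hint : IsIntegral ℤ ((1 + α) / 2) := by
    refine ⟨X ^ 2 - X - C (m : ℤ), by monicity!, ?_⟩
    simp [hsq]
  obtain ⟨ω, hω⟩ : ∃ ω : 𝓞 K, (ω : K) = (1 + α) / 2 := ⟨⟨_, hint⟩, rfl⟩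
  refine ⟨ω, by rw [hω]; ring, ?_⟩
  apply RingOfIntegers.coe_injective
  simpa [← hω] using hsq

theorem exists_eq_intCast_add_mul {m : ℕ} (hp : p.Prime) (hα : α ^ 2 = p)
    (hgen : Algebra.adjoin ℚ {α} = ⊤) (hm : p = 4 * m + 1) {ω : 𝓞 K}
    (hω : (2 * ω - 1 : K) = α) (x : 𝓞 K) : ∃ a b : ℤ, x = a + b * ω := by
  have hp0 : (p : ℚ) ≠ 0 := by exact_mod_cast hp.ne_zero
  have hαint : IsIntegral ℤ α := by
    rw [← hω]
    exact (((2 : 𝓞 K) * ω - 1 : 𝓞 K)).isIntegral_coe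
  obtain ⟨r, s, hx⟩ := exists_eq_add_mul_of_adjoin_eq_top hα hgen (x : K)
  have key (y : K) (hy : IsIntegral ℤ y) : ∃ n : ℤ, (n : ℚ) = Algebra.trace ℚ K y := by
    have := Algebra.isIntegral_trace (L := ℚ) hy
    simpa using IsIntegrallyClosed.isIntegral_iff.1 this
  have hxi : IsIntegral ℤ (x : K) := x.isIntegral_coe
  obtain ⟨A, hA⟩ := key _ hxi
  obtain ⟨B, hB⟩ := key _ (hxi.mul hαint)
  obtain ⟨D, hD⟩ := key _ (hxi.mul hxi)
  rw [hx, trace_rat_add_mul hp hα hgen] at hA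
  have e1 : ((r + s * α) * α : K) = ((s * p : ℚ) : K) + r * α := by
    push_cast; linear_combination (s : K) * hα
  have e2 : ((r + s * α) * (r + s * α) : K) =
      ((r ^ 2 + s ^ 2 * p : ℚ) : K) + (2 * r * s : ℚ) * α := by
    push_cast; linear_combination (s ^ 2 : K) * hα
  rw [hx, e1, trace_rat_add_mul hp hα hgen] at hB
  rw [hx, e2, trace_rat_add_mul hp hα hgen] at hD
  have h1 : (p : ℤ) * A ^ 2 + B ^ 2 = 2 * p * D := by
    have : ((p : ℤ) * A ^ 2 + B ^ 2 : ℚ) = 2 * p * D := by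
      rw [hA, hB, hD]; push_cast; ring
    exact_mod_cast this
  have h2 : (p : ℤ) ∣ B := by
    have : (p : ℤ) ∣ B ^ 2 := ⟨2 * D - A ^ 2, by linarith⟩
    exact Int.Prime.dvd_pow' hp this
  obtain ⟨B, rfl⟩ := h2
  have h3 : A ^ 2 + p * B ^ 2 = 2 * D := by
    have : (p : ℤ) ≠ 0 := by exact_mod_cast hp.ne_zero
    apply mul_left_cancel₀ this
    linarith
  have h4 : (2 : ℤ) ∣ A - B := by
    rw [← even_iff_two_dvd]
    have : Even (A ^ 2 + p * B ^ 2) := h3 ▸ even_two_mul D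
    rw [hm] at this
    push_cast at this
    have h5 : A ^ 2 + (4 * m + 1) * B ^ 2 = (A ^ 2 + B ^ 2) + 2 * (2 * m * B ^ 2) := by ring
    rw [h5] at this
    simpa [parity_simps] using this
  obtain ⟨E, hE⟩ := h4
  refine ⟨E, B, ?_⟩
  have hs : s * 2 = B := by
    push_cast at hB
    have : (p : ℚ) * (B - s * 2) = 0 := by linarith
    linarith [(mul_eq_zero.1 this).resolve_left hp0]
  have hr : r = E + (B : ℚ) / 2 := by
    have : (A - B : ℚ) = 2 * E := by exact_mod_cast hE
    linarith
  have hs' : s = (B : ℚ) / 2 := by linarith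
  apply RingOfIntegers.coe_injective
  have hxω : (x : K) = E + B * (ω : K) := by
    rw [hx, hr, hs', ← hω]
    push_cast
    ring
  simpa using hxω

theorem intCast_add_mul_eq_zero (hp : p.Prime) (hα : α ^ 2 = p)
    (hgen : Algebra.adjoin ℚ {α} = ⊤) {ω : 𝓞 K}
    (hω : (2 * ω - 1 : K) = α) {a b : ℤ} (h : (a + b * ω : 𝓞 K) = 0) : a = 0 ∧ b = 0 := by
  have h1 : (a + b * ω : K) = 0 := by
    have := congrArg (algebraMap (𝓞 K) K) h
    simpa using this
  have h2 : (((a + b / 2 : ℚ) : K) + ((b / 2 : ℚ) : K) * α) = 0 := by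
    rw [← hω, ← h1]; push_cast; ring
  obtain ⟨h3, h4⟩ := rat_add_mul_eq_zero hp hα hgen h2
  have hb : (b : ℚ) = 0 := by linarith
  have ha : (a : ℚ) = 0 := by linarith
  exact ⟨by exact_mod_cast ha, by exact_mod_cast hb⟩

end QuadraticField

section ClassNumberFormula

open InfinitePlace Units

variable {p : ℕ} {K : Type*} [Field K] [NumberField K] {α : K}

theorem discr_eq_of_sq_eq_prime {m : ℕ} (hp : p.Prime) (hα : α ^ 2 = p)
    (hgen : Algebra.adjoin ℚ {α} = ⊤) (hm : p = 4 * m + 1) : discr K = p := by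
  obtain ⟨ω, hω, hω2⟩ := exists_integer_sq_eq hα hm
  have hli : LinearIndependent ℤ ![(1 : 𝓞 K), ω] := by
    rw [LinearIndependent.pair_iff]
    intro a b hab
    exact intCast_add_mul_eq_zero hp hα hgen hω (by simpa using hab)
  have hsp : ⊤ ≤ Submodule.span ℤ (Set.range ![(1 : 𝓞 K), ω]) := by
    intro x _
    obtain ⟨a, b, rfl⟩ := exists_eq_intCast_add_mul hp hα hgen hm hω x
    rw [Matrix.range_cons, Matrix.range_cons, Matrix.range_empty, Set.union_empty,
      Set.singleton_union, Submodule.mem_span_pair]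
    exact ⟨a, b, by simp⟩
  have key (a b : ℤ) : Algebra.trace ℤ (𝓞 K) (a + b * ω) = 2 * a + b := by
    have h1 := Algebra.coe_trace_int (K := K) (a + b * ω)
    have h2 : ((a + b * ω : 𝓞 K) : K) = ((a + b / 2 : ℚ) : K) + ((b / 2 : ℚ) : K) * α := by
      rw [← hω]; push_cast; simp; ring
    rw [h2, trace_rat_add_mul hp hα hgen] at h1
    have h3 : (Algebra.trace ℤ (𝓞 K) (a + b * ω) : ℚ) = 2 * a + b := by rw [h1]; ring
    exact_mod_cast h3
  have k1 := key 1 0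
  have k2 := key 0 1
  have k3 := key m 1
  have h3 : ω * ω = m + ω := by rw [← sq, hω2, add_comm]
  simp only [Int.cast_one, Int.cast_zero, zero_mul, add_zero, one_mul, zero_add,
    Int.cast_natCast] at k1 k2 k3
  rw [← NumberField.discr_eq_discr K (Module.Basis.mk hli hsp), Algebra.discr_def,
    Matrix.det_fin_two]
  simp only [Algebra.traceMatrix_apply, Algebra.traceForm_apply, Module.Basis.mk_apply,
    Matrix.cons_val_zero, Matrix.cons_val_one, one_mul, mul_one, k1, k2, k3, h3]
  rw [hm]
  push_cast
  ring

theorem nrPlaces_of_finrank_eq_two (h2 : Module.finrank ℚ K = 2) (f : K →+* ℝ) :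
    nrRealPlaces K = 2 ∧ nrComplexPlaces K = 0 := by
  classical
  have h := card_add_two_mul_card_eq_rank K
  rw [h2] at h
  have : 0 < nrRealPlaces K := by
    rw [nrRealPlaces, Fintype.card_pos_iff]
    refine ⟨⟨InfinitePlace.mk (Complex.ofRealHom.comp f), ?_⟩⟩
    rw [isReal_mk_iff, ComplexEmbedding.isReal_iff]
    ext x
    simp [ComplexEmbedding.conjugate_coe_eq]
  omega

theorem torsionOrder_eq_two_of_ringHom_real (f : K →+* ℝ) : torsionOrder K = 2 := by
  classical
  have := Fintype.ofFinite (torsion K)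
  rw [torsionOrder, Nat.card_eq_fintype_card]
  refine (Finset.card_eq_two.2 ⟨1, ⟨-1, neg_one_mem_torsion⟩,
    by simp [← Subtype.coe_ne_coe], Finset.ext fun x ↦ ⟨fun _ ↦ ?_, fun _ ↦ Finset.mem_univ _⟩⟩)
  rw [Finset.mem_insert, Finset.mem_singleton, ← Subtype.val_inj, ← Subtype.val_inj]
  obtain ⟨x, hx⟩ := x
  rw [mem_torsion] at hx
  have h1 : |f (x : K)| = 1 := by
    have := hx (InfinitePlace.mk (Complex.ofRealHom.comp f))
    simpa using this
  have h2 : f (x : K) = f 1 ∨ f (x : K) = f (-1) := by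
    rcases abs_eq (zero_le_one) |>.1 h1 with h | h
    · left; simp [h]
    · right; simp [h]
  rcases h2 with h | h
  · left
    apply Units.ext
    apply RingOfIntegers.coe_injective
    simpa using f.injective h
  · right
    apply Units.ext
    apply RingOfIntegers.coe_injective
    simpa using f.injective h

theorem regulator_eq_log (h2 : Module.finrank ℚ K = 2) (f : K →+* ℝ) {ε : (𝓞 K)ˣ}
    (hε1 : 1 < f ((ε : 𝓞 K) : K)) (hfund : ∀ v : (𝓞 K)ˣ, ∃ n : ℤ, v = ε ^ n ∨ v = -ε ^ n) :
    regulator K = Real.log (f ((ε : 𝓞 K) : K)) := by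
  classical
  obtain ⟨hr1, hr2⟩ := nrPlaces_of_finrank_eq_two h2 f
  have hcard : Fintype.card (InfinitePlace K) = 2 := by
    rw [card_eq_nrRealPlaces_add_nrComplexPlaces, hr1, hr2]
  have hrank : rank K = 1 := by rw [rank, hcard]
  have hindex : (Subgroup.closure (Set.range fun _ : Fin (rank K) => ε) ⊔ torsion K).index = 1 := by
    rw [Subgroup.index_eq_one, eq_top_iff]
    intro v _
    have he : ε ∈ Subgroup.closure (Set.range fun _ : Fin (rank K) => ε) :=
      Subgroup.subset_closure ⟨⟨0, by omega⟩, rfl⟩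
    have he' (n : ℤ) := Subgroup.mem_sup_left (T := torsion K) (Subgroup.zpow_mem _ he n)
    obtain ⟨n, rfl | rfl⟩ := hfund v
    · exact he' n
    · rw [← neg_one_mul]
      exact mul_mem (Subgroup.mem_sup_right neg_one_mem_torsion) (he' n)
  have hreg := regOfFamily_div_regulator fun _ : Fin (rank K) => ε
  rw [hindex, Nat.cast_one, div_eq_one_iff_eq (regulator_pos K).ne'] at hreg
  set w := InfinitePlace.mk (Complex.ofRealHom.comp f) with hw
  obtain ⟨w', hw'⟩ : ∃ w', w' ≠ w :=
    @exists_ne _ (Fintype.one_lt_card_iff_nontrivial.1 (by omega)) w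
  have hc : Fintype.card {v : InfinitePlace K // v ≠ w'} = 1 := by
    rw [Fintype.card_subtype_compl, Fintype.card_subtype_eq, hcard]
  let e : {v : InfinitePlace K // v ≠ w'} ≃ Fin (rank K) :=
    Fintype.equivOfCardEq (by rw [hc, Fintype.card_fin, hrank])
  have : Subsingleton {v : InfinitePlace K // v ≠ w'} :=
    Fintype.card_le_one_iff_subsingleton.1 hc.le
  have hmult : mult w = 1 := by
    refine IsReal.mult_eq_one ?_
    rw [hw, isReal_mk_iff, ComplexEmbedding.isReal_iff]
    ext x
    simp [ComplexEmbedding.conjugate_coe_eq]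
  rw [← hreg, regOfFamily_eq_det _ w' e, Matrix.det_eq_elem_of_subsingleton _ ⟨w, hw'.symm⟩]
  have hwε : w ((ε : 𝓞 K) : K) = f ((ε : 𝓞 K) : K) := by
    rw [hw, InfinitePlace.apply]
    simpa using (zero_lt_one.trans hε1).le
  simp only [Matrix.of_apply, hmult, hwε, Nat.cast_one, one_mul]
  exact abs_of_pos (Real.log_pos hε1)

theorem dedekindZeta_residue_eq_of_sq_eq_prime {m : ℕ} (hp : p.Prime) (hα : α ^ 2 = p)
    (hgen : Algebra.adjoin ℚ {α} = ⊤) (hm : p = 4 * m + 1) (f : K →+* ℝ) {ε : (𝓞 K)ˣ}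
    (hε1 : 1 < f ((ε : 𝓞 K) : K)) (hfund : ∀ v : (𝓞 K)ˣ, ∃ n : ℤ, v = ε ^ n ∨ v = -ε ^ n) :
    dedekindZeta_residue K =
      2 * classNumber K * Real.log (f ((ε : 𝓞 K) : K)) / Real.sqrt p := by
  have h2 := finrank_eq_two_of_sq_eq_prime hp hα hgen
  obtain ⟨hr1, hr2⟩ := nrPlaces_of_finrank_eq_two h2 f
  rw [dedekindZeta_residue_def, hr1, hr2, torsionOrder_eq_two_of_ringHom_real f,
    regulator_eq_log h2 f hε1 hfund, discr_eq_of_sq_eq_prime hp hα hgen hm]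
  have hs : Real.sqrt p ≠ 0 := Real.sqrt_ne_zero'.2 (by exact_mod_cast hp.pos)
  simp only [Int.cast_natCast, Nat.abs_cast]
  field_simp
  push_cast
  ring

theorem sq_sub_mul_sq_eq_of_unit {m : ℕ} (hp : p.Prime) (hα : α ^ 2 = p)
    (hgen : Algebra.adjoin ℚ {α} = ⊤) (hm : p = 4 * m + 1) {t u : ℕ} {ε : (𝓞 K)ˣ}
    (hε : ((ε : 𝓞 K) : K) = ((t : K) + (u : K) * α) / 2) :
    (t : ℤ) ^ 2 - p * u ^ 2 = 4 ∨ (t : ℤ) ^ 2 - p * u ^ 2 = -4 := by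
  obtain ⟨ω, hω, hω2⟩ := exists_integer_sq_eq hα hm
  obtain ⟨a, b, hab⟩ := exists_eq_intCast_add_mul hp hα hgen hm hω (ε : 𝓞 K)
  obtain ⟨c, d, hcd⟩ := exists_eq_intCast_add_mul hp hα hgen hm hω (ε⁻¹ : (𝓞 K)ˣ)
  have h1 : ((a + b * ω) * (c + d * ω) : 𝓞 K) = 1 := by rw [← hab, ← hcd, Units.mul_inv]
  have h2 : ((a * c + b * d * m - 1 : ℤ) + (a * d + b * c + b * d : ℤ) * ω : 𝓞 K) = 0 := by
    push_cast
    linear_combination h1 - (b * d : 𝓞 K) * hω2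
  obtain ⟨h3, h4⟩ := intCast_add_mul_eq_zero hp hα hgen hω h2
  have h5 : ((t - 2 * a - b : ℚ) : K) + ((u - b : ℚ) : K) * α = 0 := by
    have h6 : ((ε : 𝓞 K) : K) = a + b * (ω : K) := by rw [hab]; simp
    rw [h6, ← hω] at hε
    rw [← hω]
    push_cast
    linear_combination (-2 : K) * hε
  obtain ⟨h6, h7⟩ := rat_add_mul_eq_zero hp hα hgen h5
  have h8 : (t : ℤ) = 2 * a + b := by
    have : (t : ℚ) = 2 * a + b := by linarith
    exact_mod_cast this
  have h9 : (u : ℤ) = b := by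
    have : (u : ℚ) = b := by linarith
    exact_mod_cast this
  have hN : (a ^ 2 + a * b - m * b ^ 2) * (c ^ 2 + c * d - m * d ^ 2) = 1 := by
    have h10 : a * c + b * d * m = 1 := by linarith
    linear_combination (a * c + b * d * m + 1) * h10 +
      (a * c + b * d * m - (a * d + b * c + b * d) * m) * h4
  have hm' : (p : ℤ) = 4 * m + 1 := by exact_mod_cast hm
  rw [h8, h9, hm']
  rcases Int.eq_one_or_neg_one_of_mul_eq_one hN with h | h
  · left; linear_combination 4 * h
  · right; linear_combination 4 * h

end ClassNumberFormula

section PrimeSplitting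

open Ideal

variable {K : Type*} [Field K] [NumberField K]

theorem absNorm_span_natCast_of_finrank_eq_two (h2 : Module.finrank ℚ K = 2) (n : ℕ) :
    absNorm (span {(n : 𝓞 K)}) = n ^ 2 := by
  rw [absNorm_span_natCast, RingOfIntegers.rank, h2]

theorem eq_of_le_of_absNorm_prime {P Q : Ideal (𝓞 K)} (hP : (absNorm P).Prime) (hQ : Q.IsPrime)
    (h : P ≤ Q) : Q = P := by
  have hP' : P.IsPrime := isPrime_of_irreducible_absNorm hP
  have hP0 : P ≠ ⊥ := fun h0 => hP.ne_zero (by rw [h0, absNorm_bot])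
  exact ((hP'.isMaximal hP0).eq_of_le hQ.ne_top h).symm

variable {m : ℕ} {ω : 𝓞 K}

theorem idealCount_prime_pow_of_root (h2 : Module.finrank ℚ K = 2) (hω : ω ^ 2 = ω + m)
    (hind : ∀ a b : ℤ, (a + b * ω : 𝓞 K) = 0 → a = 0 ∧ b = 0)
    (hspan : ∀ x : 𝓞 K, ∃ a b : ℤ, x = a + b * ω) {q : ℕ} (hq : q.Prime) {c : ℤ}
    (hc : (q : ℤ) ∣ c ^ 2 - c - m) (hcop : IsCoprime (2 * c - 1) (q : ℤ)) (k : ℕ) :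
    idealCount K (q ^ k) = k + 1 := by
  set P₁ := span {(q : 𝓞 K), ω - c} with hP₁
  set P₂ := span {(q : 𝓞 K), ω - 1 + c} with hP₂
  have hq₁ : (q : 𝓞 K) ∈ P₁ := subset_span (by simp)
  have hq₂ : (q : 𝓞 K) ∈ P₂ := subset_span (by simp)
  have hs : P₁ ⊔ P₂ = ⊤ := by
    rw [eq_top_iff_one]
    obtain ⟨a, b, hab⟩ := hcop
    have h1 : (1 : 𝓞 K) = -a * ((ω - c) - (ω - 1 + c)) + b * q := by
      have h2 : (a * (2 * c - 1) + b * q : 𝓞 K) = 1 := by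
        exact_mod_cast congrArg (Int.cast (R := 𝓞 K)) hab
      linear_combination -h2
    rw [h1]
    refine add_mem (mul_mem_left _ _ (sub_mem (mem_sup_left (subset_span ?_))
      (mem_sup_right (subset_span ?_)))) (mul_mem_left _ _ (mem_sup_left hq₁)) <;> simp
  have hmul : P₁ * P₂ = span {(q : 𝓞 K)} := by
    refine le_antisymm ?_ ?_
    · obtain ⟨e, he⟩ := hc
      have he' : ((c : 𝓞 K) ^ 2 - c - m) = q * e := by
        exact_mod_cast congrArg (Int.cast (R := 𝓞 K)) he
      rw [hP₁, hP₂, span_pair_mul_span_pair, span_le]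
      rintro x (rfl | rfl | rfl | rfl)
      · exact mem_span_singleton.2 ⟨q, rfl⟩
      · exact mem_span_singleton.2 ⟨_, rfl⟩
      · exact mem_span_singleton.2 ⟨_, mul_comm _ _⟩
      · exact mem_span_singleton.2 ⟨-e, by linear_combination hω - he'⟩
    · rw [mul_eq_inf_of_coprime hs, span_singleton_le_iff_mem]
      exact ⟨hq₁, hq₂⟩
  have hnot (d : ℤ) : ω + d ∉ span {(q : 𝓞 K)} := by
    intro hd
    obtain ⟨y, hy⟩ := mem_span_singleton.1 hd
    obtain ⟨a, b, rfl⟩ := hspan y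
    have h3 := (hind (d - q * a) (1 - q * b) (by push_cast; linear_combination hy)).2
    have h4 : (q : ℤ) ∣ 1 := ⟨b, by linarith⟩
    have h5 : q ∣ 1 := by exact_mod_cast h4
    exact hq.one_lt.ne' (Nat.dvd_one.1 h5)
  have hP₁top : P₁ ≠ ⊤ := by
    intro h
    refine hnot (-1 + c) ?_
    rw [← hmul, h, top_mul]
    exact subset_span (by simp; right; ring)
  have hP₂top : P₂ ≠ ⊤ := by
    intro h
    refine hnot (-c) ?_
    rw [← hmul, h, mul_top]
    exact subset_span (by simp; right; ring)
  have hN : absNorm P₁ * absNorm P₂ = q ^ 2 := by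
    rw [← map_mul, hmul, absNorm_span_natCast_of_finrank_eq_two h2]
  obtain ⟨hN₁, hN₂⟩ := (Nat.Prime.mul_eq_prime_sq_iff hq
    (fun h => hP₁top (absNorm_eq_one_iff.1 h)) (fun h => hP₂top (absNorm_eq_one_iff.1 h))).1 hN
  refine idealCount_prime_pow_of_split hq (P₁ := P₁) (P₂ := P₂) ?_ hN₁ hN₂ ?_ k
  · intro P hP hqP
    have hle : P₁ * P₂ ≤ P := by
      rw [hmul, span_singleton_le_iff_mem]
      exact hqP
    rcases hP.mul_le.1 hle with h | h
    · exact Or.inl (eq_of_le_of_absNorm_prime (hN₁ ▸ hq) hP h)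
    · exact Or.inr (eq_of_le_of_absNorm_prime (hN₂ ▸ hq) hP h)
  · intro h
    rw [← h, sup_idem] at hs
    exact hP₁top hs

theorem idealCount_prime_pow_of_no_root (h2 : Module.finrank ℚ K = 2) (hω : ω ^ 2 = ω + m)
    {q : ℕ} (hq : q.Prime) (hc : ∀ c : ZMod q, c ^ 2 ≠ c + m) (k : ℕ) :
    idealCount K (q ^ k) = if Even k then 1 else 0 := by
  have hN := absNorm_span_natCast_of_finrank_eq_two h2 q
  simp only [even_iff_two_dvd]
  refine idealCount_prime_pow_of_unique hq two_ne_zero (P := span {(q : 𝓞 K)}) ?_ hN k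
  intro Q hQ hqQ
  have hle : span {(q : 𝓞 K)} ≤ Q := by rwa [span_singleton_le_iff_mem]
  obtain ⟨J, hJ⟩ := dvd_iff_le.2 hle
  have hNJ : absNorm Q * absNorm J = q ^ 2 := by rw [← map_mul, ← hJ, hN]
  by_cases hJ1 : absNorm J = 1
  · rw [hJ, absNorm_eq_one_iff.1 hJ1, mul_top]
  obtain ⟨hNQ, -⟩ := (Nat.Prime.mul_eq_prime_sq_iff hq
    (fun h => hQ.ne_top (absNorm_eq_one_iff.1 h)) hJ1).1 hNJ
  have hfin : Finite (𝓞 K ⧸ Q) := (absNorm_ne_zero_iff Q).1 (hNQ ▸ hq.ne_zero)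
  have := Fintype.ofFinite (𝓞 K ⧸ Q)
  have hcard : Fintype.card (𝓞 K ⧸ Q) = q := by
    rw [← Nat.card_eq_fintype_card, ← hNQ]
    rfl
  let e := ZMod.ringEquivOfPrime (𝓞 K ⧸ Q) hq hcard
  refine absurd ?_ (hc (e.symm (Ideal.Quotient.mk Q ω)))
  rw [← map_pow, ← map_pow, hω, map_add, map_add, map_natCast, map_natCast]

theorem idealCount_prime_pow_of_ramified (h2 : Module.finrank ℚ K = 2) {β : 𝓞 K} {q : ℕ}
    (hq : q.Prime) (hβ : β ^ 2 = q) (k : ℕ) : idealCount K (q ^ k) = 1 := by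
  have hN : absNorm (span {β}) = q := by
    have h1 := absNorm_span_natCast_of_finrank_eq_two h2 q
    rw [← hβ, ← span_singleton_pow, map_pow] at h1
    exact Nat.pow_left_injective two_ne_zero h1
  rw [idealCount_prime_pow_of_unique hq one_ne_zero (P := span {β}) ?_ (by rw [hN, pow_one]) k,
    if_pos (one_dvd k)]
  intro Q hQ hqQ
  refine eq_of_le_of_absNorm_prime (hN ▸ hq) hQ ?_
  rw [span_singleton_le_iff_mem]
  rw [← hβ] at hqQ
  exact hQ.mem_of_pow_mem 2 hqQ

end PrimeSplitting

section Reciprocity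

theorem exists_sq_eq_add_iff_zmod_two : ∀ x : ZMod 2, (∃ c, c ^ 2 = c + x) ↔ x = 0 := by
  decide

theorem isSquare_iff_exists_root {p m q : ℕ} [Fact p.Prime] [Fact q.Prime] (hm : p = 4 * m + 1) :
    IsSquare (q : ZMod p) ↔ ∃ c : ZMod q, c ^ 2 = c + m := by
  rcases eq_or_ne q 2 with rfl | hq2
  · have hp8 : IsSquare (((2 : ℕ) : ZMod p)) ↔ _ := ZMod.exists_sq_eq_two_iff (p := p) (by omega)
    rw [exists_sq_eq_add_iff_zmod_two, ZMod.natCast_eq_zero_iff, hp8]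
    omega
  · rw [ZMod.exists_sq_eq_prime_iff_of_mod_four_eq_one (by omega) hq2]
    have h2 : (2 : ZMod q) ≠ 0 := Ring.two_ne_zero (by rwa [ZMod.ringChar_zmod_n])
    have hp' : (p : ZMod q) = 4 * m + 1 := by rw [hm]; push_cast; ring
    constructor
    · rintro ⟨d, hd⟩
      refine ⟨(d + 1) / 2, ?_⟩
      field_simp
      linear_combination hp' - hd
    · rintro ⟨c, hc⟩
      exact ⟨2 * c - 1, by linear_combination hp' - 4 * hc⟩

end Reciprocity

section ZetaFactorization

open Filter Topology

theorem toArithmeticFunction_apply_of_ne_zero {R : Type*} [Zero R] (g : ℕ → R) {n : ℕ}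
    (hn : n ≠ 0) : toArithmeticFunction g n = g n :=
  if_neg hn

theorem zetaMul_prime_pow {N : ℕ} (χ : DirichletCharacter ℂ N) {q : ℕ} (hq : q.Prime) (k : ℕ) :
    χ.zetaMul (q ^ k) = ∑ i ∈ Finset.range (k + 1), χ q ^ i := by
  rw [DirichletCharacter.zetaMul, ArithmeticFunction.coe_zeta_mul_apply,
    Nat.sum_divisors_prime_pow hq]
  refine Finset.sum_congr rfl fun i _ => ?_
  rw [toArithmeticFunction_apply_of_ne_zero _ (pow_ne_zero i hq.ne_zero)]
  simp

theorem toArithmeticFunction_natCast_isMultiplicative {g : ℕ → ℕ} (h1 : g 1 = 1)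
    (hg : ∀ {m n : ℕ}, m.Coprime n → g (m * n) = g m * g n) :
    (toArithmeticFunction fun n => (g n : ℂ)).IsMultiplicative := by
  refine ArithmeticFunction.IsMultiplicative.iff_ne_zero.2 ⟨?_, fun {m n} hm hn hmn => ?_⟩
  · simp [toArithmeticFunction, h1]
  · simp [toArithmeticFunction, hm, hn, hg hmn]

variable {p : ℕ} [Fact p.Prime] {K : Type*} [Field K] [NumberField K] {α : K}

theorem idealCount_one : idealCount K 1 = 1 := by
  rw [idealCount, Nat.card_eq_one_iff_unique]
  refine ⟨⟨fun I J => Subtype.ext ?_⟩, ⟨⟨⊤, Ideal.absNorm_top⟩⟩⟩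
  rw [Ideal.absNorm_eq_one_iff.1 I.2, Ideal.absNorm_eq_one_iff.1 J.2]

theorem idealCount_eq_zetaMul (hp4 : p % 4 = 1) (hα : α ^ 2 = p)
    (hgen : Algebra.adjoin ℚ {α} = ⊤) {n : ℕ} (hn : n ≠ 0) :
    (idealCount K n : ℂ) = (complexQuadraticChar p).zetaMul n := by
  have hp : p.Prime := Fact.out
  obtain ⟨m, hm⟩ : ∃ m, p = 4 * m + 1 := ⟨p / 4, by omega⟩
  have h2 := finrank_eq_two_of_sq_eq_prime hp hα hgen
  obtain ⟨ω, hω, hω2⟩ := exists_integer_sq_eq hα hm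
  have hspan := exists_eq_intCast_add_mul hp hα hgen hm hω
  have hind := fun a b => intCast_add_mul_eq_zero hp hα hgen hω (a := a) (b := b)
  have h : (toArithmeticFunction fun n => (idealCount K n : ℂ)) =
      (complexQuadraticChar p).zetaMul := by
    rw [ArithmeticFunction.IsMultiplicative.eq_iff_eq_on_prime_powers _
      (toArithmeticFunction_natCast_isMultiplicative idealCount_one idealCount_mul_of_coprime) _
      (DirichletCharacter.isMultiplicative_zetaMul _)]
    intro q k hq
    have := Fact.mk hq
    rw [zetaMul_prime_pow _ hq, complexQuadraticChar_apply,
      toArithmeticFunction_apply_of_ne_zero _ (pow_ne_zero k hq.ne_zero)]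
    rcases eq_or_ne q p with rfl | hqp
    · have hβ : (2 * ω - 1) ^ 2 = (q : 𝓞 K) := by
        rw [hm]; push_cast; linear_combination 4 * hω2
      rw [idealCount_prime_pow_of_ramified h2 hq hβ]
      simp [Finset.sum_range_succ']
    have hq0 : (q : ZMod p) ≠ 0 := by
      rw [Ne, ZMod.natCast_eq_zero_iff, Nat.prime_dvd_prime_iff_eq hp hq]
      exact hqp.symm
    by_cases hsq : IsSquare (q : ZMod p)
    · obtain ⟨c, hc⟩ := (isSquare_iff_exists_root hm).1 hsq
      obtain ⟨c, rfl⟩ := ZMod.intCast_surjective c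
      have hc' : (q : ℤ) ∣ c ^ 2 - c - m := by
        rw [← ZMod.intCast_zmod_eq_zero_iff_dvd]
        push_cast
        linear_combination hc
      have hcop : IsCoprime (2 * c - 1) (q : ℤ) := by
        rw [isCoprime_comm, (Nat.prime_iff_prime_int.1 hq).coprime_iff_not_dvd]
        intro hdvd
        have h3 : (q : ℤ) ∣ p := by
          have : (p : ℤ) = (2 * c - 1) * (2 * c - 1) - 4 * (c ^ 2 - c - m) := by
            rw [hm]; push_cast; ring
          rw [this]
          exact dvd_sub (hdvd.mul_left _) (hc'.mul_left _)
        exact hqp ((Nat.prime_dvd_prime_iff_eq hq hp).1 (by exact_mod_cast h3))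
      rw [idealCount_prime_pow_of_root h2 hω2 hind hspan hq hc' hcop,
        (quadraticChar_one_iff_isSquare hq0).2 hsq]
      simp
    · have hno : ∀ c : ZMod q, c ^ 2 ≠ c + m := fun c hc =>
        hsq ((isSquare_iff_exists_root hm).2 ⟨c, hc⟩)
      rw [idealCount_prime_pow_of_no_root h2 hω2 hq hno,
        quadraticChar_neg_one_iff_not_isSquare.2 hsq]
      push_cast
      rw [neg_one_geom_sum]
      by_cases hk : Even k <;> simp [Nat.even_add_one, hk]
  rw [← h]
  exact (toArithmeticFunction_apply_of_ne_zero (fun n => (idealCount K n : ℂ)) hn).symm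

theorem dedekindZeta_eq_mul (hp4 : p % 4 = 1) (hα : α ^ 2 = p)
    (hgen : Algebra.adjoin ℚ {α} = ⊤) {s : ℂ} (hs : 1 < s.re) :
    dedekindZeta K s = riemannZeta s * LSeries (fun n => complexQuadraticChar p n) s := by
  have h0 : dedekindZeta K s = LSeries (complexQuadraticChar p).zetaMul s :=
    LSeries_congr (fun hn => idealCount_eq_zetaMul hp4 hα hgen hn) s
  have h1 : LSeries (toArithmeticFunction fun n => complexQuadraticChar p n) s =
      LSeries (fun n => complexQuadraticChar p n) s :=
    LSeries_congr (fun {n} hn => toArithmeticFunction_apply_of_ne_zero _ hn) s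
  have h2 : LSeriesSummable (toArithmeticFunction fun n => complexQuadraticChar p n) s :=
    (LSeriesSummable_congr _
      fun {n} hn => toArithmeticFunction_apply_of_ne_zero _ hn).2
      (ZMod.LSeriesSummable_of_one_lt_re _ hs)
  rw [h0, DirichletCharacter.zetaMul, ArithmeticFunction.LSeries_mul' _ h2, h1]
  · congr 1
    exact ArithmeticFunction.LSeries_zeta_eq_riemannZeta hs
  · exact ArithmeticFunction.LSeriesSummable_zeta_iff.2 hs

theorem tendsto_LSeries_complexQuadraticChar (hp4 : p % 4 = 1) (hα : α ^ 2 = p)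
    (hgen : Algebra.adjoin ℚ {α} = ⊤) :
    Tendsto (fun s : ℝ => LSeries (fun n => complexQuadraticChar p n) s) (𝓝[>] 1)
      (𝓝 (dedekindZeta_residue K : ℂ)) := by
  have h1 := NumberField.tendsto_sub_one_mul_dedekindZeta_nhdsGT K
  have h2 : Tendsto (fun s : ℝ => ((s : ℂ) - 1) * riemannZeta s) (𝓝[>] 1) (𝓝 1) := by
    refine riemannZeta_residue_one.comp ?_
    refine tendsto_nhdsWithin_iff.2 ⟨?_, ?_⟩
    · exact (Complex.continuous_ofReal.tendsto' 1 1 Complex.ofReal_one).mono_left nhdsWithin_le_nhds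
    · filter_upwards [self_mem_nhdsWithin] with s hs
      simpa using (ne_of_gt hs)
  have h3 := h1.div h2 one_ne_zero
  rw [div_one] at h3
  refine h3.congr' ?_
  filter_upwards [self_mem_nhdsWithin] with s hs
  have hs' : 1 < (s : ℂ).re := by simpa using hs
  have hne : (s : ℂ) - 1 ≠ 0 := sub_ne_zero.2 (by simpa using (ne_of_gt hs))
  simp only [Pi.div_apply]
  rw [dedekindZeta_eq_mul hp4 hα hgen hs', ← mul_assoc,
    mul_div_cancel_left₀ _ (mul_ne_zero hne (riemannZeta_ne_zero_of_one_lt_re hs'))]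

end ZetaFactorization

section QuadraticResidueProduct

open Complex ComplexConjugate

variable {p : ℕ} [Fact p.Prime] {ζ : ℂ}

theorem pow_val_neg (hζ : IsPrimitiveRoot ζ p) (c : ZMod p) : ζ ^ (-c).val = conj (ζ ^ c.val) := by
  have hp : p.Prime := Fact.out
  have hnorm : ‖ζ ^ c.val‖ = 1 := by
    rw [norm_pow, hζ.norm'_eq_one hp.ne_zero, one_pow]
  rw [← inv_eq_conj hnorm, ← AddChar.zmodChar_apply hζ.pow_eq_one,
    ← AddChar.zmodChar_apply hζ.pow_eq_one, AddChar.map_neg_eq_inv]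

theorem log_one_sub_pow_val_neg (hζ : IsPrimitiveRoot ζ p) (c : ZMod p) :
    log (1 - ζ ^ (-c).val) = conj (log (1 - ζ ^ c.val)) := by
  have hp : p.Prime := Fact.out
  have hre : (ζ ^ c.val).re ≤ 1 := (re_le_norm _).trans_eq (by
    rw [norm_pow, hζ.norm'_eq_one hp.ne_zero, one_pow])
  rw [pow_val_neg hζ, ← log_conj, map_sub, map_one]
  rw [Ne, arg_eq_pi_iff, sub_re, one_re]
  intro h
  linarith [h.1]

theorem neg_mem_quadraticResidues (hp4 : p % 4 = 1) {c : ZMod p}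
    (hc : c ∈ quadraticResidues p) : -c ∈ quadraticResidues p := by
  rw [mem_quadraticResidues] at hc ⊢
  have h1 : quadraticChar (ZMod p) (-1) = 1 :=
    (quadraticChar_one_iff_isSquare (neg_ne_zero.2 one_ne_zero)).2
      (ZMod.exists_sq_eq_neg_one_iff.2 (by omega))
  rw [← neg_one_mul, map_mul, h1, hc, one_mul]

theorem sum_log_one_sub_pow_eq (hp4 : p % 4 = 1) (hζ : IsPrimitiveRoot ζ p) :
    ∑ c ∈ quadraticResidues p, log (1 - ζ ^ c.val) =
      (∑ c ∈ quadraticResidues p, Real.log ‖1 - ζ ^ c.val‖ : ℝ) := by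
  have h : conj (∑ c ∈ quadraticResidues p, log (1 - ζ ^ c.val)) =
      ∑ c ∈ quadraticResidues p, log (1 - ζ ^ c.val) := by
    rw [map_sum]
    refine Finset.sum_nbij' (fun c => -c) (fun c => -c)
      (fun c hc => neg_mem_quadraticResidues hp4 hc) (fun c hc => neg_mem_quadraticResidues hp4 hc)
      (fun c _ => neg_neg c) (fun c _ => neg_neg c) fun c _ => ?_
    exact (log_one_sub_pow_val_neg hζ c).symm
  rw [← conj_eq_iff_re.1 h, re_sum]
  simp only [log_re]

theorem prod_quadraticResidues_one_sub_pow (hp4 : p % 4 = 1) (hζ : IsPrimitiveRoot ζ p) :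
    ∏ c ∈ quadraticResidues p, (1 - ζ ^ c.val) =
      (Real.exp (∑ c ∈ quadraticResidues p, Real.log ‖1 - ζ ^ c.val‖) : ℝ) := by
  rw [ofReal_exp, ← sum_log_one_sub_pow_eq hp4 hζ, exp_sum]
  refine Finset.prod_congr rfl fun c hc => (exp_log ?_).symm
  rw [sub_ne_zero, ne_comm, Ne, hζ.pow_eq_one_iff_dvd]
  intro h
  have hc0 : c.val = 0 := Nat.eq_zero_of_dvd_of_lt h (ZMod.val_lt c)
  rw [ZMod.val_eq_zero] at hc0
  rw [mem_quadraticResidues, hc0, quadraticChar_zero] at hc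
  exact zero_ne_one hc

theorem sum_log_norm_one_sub_pow (hζ : IsPrimitiveRoot ζ p) :
    ∑ c : ZMod p, Real.log ‖1 - ζ ^ c.val‖ = Real.log p := by
  have hp : p.Prime := Fact.out
  rw [ZMod.sum_range_val fun n => Real.log ‖1 - ζ ^ n‖]
  obtain ⟨n, rfl⟩ := Nat.exists_eq_succ_of_ne_zero hp.ne_zero
  rw [Finset.sum_range_succ', pow_zero, sub_self, norm_zero, Real.log_zero, add_zero,
    ← Real.log_prod, ← norm_prod, hζ.prod_one_sub_pow_eq_order]
  · norm_cast
  · intro k hk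
    rw [norm_ne_zero_iff, sub_ne_zero, ne_comm, Ne, hζ.pow_eq_one_iff_dvd]
    intro h
    have := Nat.le_of_dvd k.succ_pos h
    have := Finset.mem_range.1 hk
    omega

theorem sum_quadraticChar_mul_log (hζ : IsPrimitiveRoot ζ p) :
    ∑ c : ZMod p, (quadraticChar (ZMod p) c : ℝ) * Real.log ‖1 - ζ ^ c.val‖ =
      2 * ∑ c ∈ quadraticResidues p, Real.log ‖1 - ζ ^ c.val‖ - Real.log p := by
  rw [← sum_log_norm_one_sub_pow hζ, quadraticResidues, Finset.sum_filter, Finset.mul_sum,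
    ← Finset.sum_sub_distrib]
  refine Finset.sum_congr rfl fun c _ => ?_
  rcases eq_or_ne c 0 with rfl | hc
  · simp
  rcases quadraticChar_dichotomy hc with h | h
  · rw [if_pos h, h]
    push_cast
    ring
  · rw [if_neg (by rw [h]; decide), h]
    push_cast
    ring

variable {K : Type*} [Field K] [NumberField K] {α : K}

/-- Dirichlet's class number formula for `ℚ(√p)`, where `e` is the sign of the Gauss sum. -/
theorem two_mul_classNumber_mul_log (hp4 : p % 4 = 1) (hζ : IsPrimitiveRoot ζ p)
    (hα : α ^ 2 = p) (hgen : Algebra.adjoin ℚ {α} = ⊤) (f : K →+* ℝ) {ε : (𝓞 K)ˣ}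
    (hε1 : 1 < f ((ε : 𝓞 K) : K)) (hfund : ∀ v : (𝓞 K)ˣ, ∃ n : ℤ, v = ε ^ n ∨ v = -ε ^ n)
    {e : ℝ} (hτ : ∑ c : ZMod p, (quadraticChar (ZMod p) c : ℂ) * ζ ^ c.val =
      (e * Real.sqrt p : ℝ)) :
    e * (2 * classNumber K * Real.log (f ((ε : 𝓞 K) : K))) =
      Real.log p - 2 * ∑ c ∈ quadraticResidues p, Real.log ‖1 - ζ ^ c.val‖ := by
  have hp : p.Prime := Fact.out
  obtain ⟨m, hm⟩ : ∃ m, p = 4 * m + 1 := ⟨p / 4, by omega⟩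
  have hs : Real.sqrt p ≠ 0 := Real.sqrt_ne_zero'.2 (by exact_mod_cast hp.pos)
  have h1 := tendsto_nhds_unique (tendsto_gaussSum_mul_LSeries (by omega) hζ)
    ((tendsto_LSeries_complexQuadraticChar hp4 hα hgen).const_mul _)
  rw [hτ, dedekindZeta_residue_eq_of_sq_eq_prime hp hα hgen hm f hε1 hfund, ← ofReal_mul] at h1
  have h2 := congrArg re h1
  rw [ofReal_re, neg_re, re_sum] at h2
  have h3 (c : ZMod p) : ((quadraticChar (ZMod p) c : ℂ) * log (1 - ζ ^ c.val)).re =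
      (quadraticChar (ZMod p) c : ℝ) * Real.log ‖1 - ζ ^ c.val‖ := by
    rw [← log_re, ← ofReal_intCast, re_ofReal_mul]
  simp only [h3] at h2
  rw [sum_quadraticChar_mul_log hζ] at h2
  rw [← neg_sub, h2]
  field_simp

theorem natCast_pow_classNumber_eq (hp4 : p % 4 = 1) (hα : α ^ 2 = p)
    (hgen : Algebra.adjoin ℚ {α} = ⊤) (f : K →+* ℝ) (hfα : 0 ≤ f α) {t u : ℕ} {ε : (𝓞 K)ˣ}
    (hε : ((ε : 𝓞 K) : K) = ((t : K) + (u : K) * α) / 2)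
    (hε1 : 1 < f ((ε : 𝓞 K) : K)) (hfund : ∀ v : (𝓞 K)ˣ, ∃ n : ℤ, v = ε ^ n ∨ v = -ε ^ n) :
    (t : ZMod p) ^ classNumber K =
      -2 ^ classNumber K * ((p / 2).factorial : ZMod p) := by
  have hp : p.Prime := Fact.out
  have hp0 : (0 : ℝ) < p := by exact_mod_cast hp.pos
  have hζ : IsPrimitiveRoot (exp (2 * Real.pi * I / p)) p := isPrimitiveRoot_exp p hp.ne_zero
  set ζ := exp (2 * Real.pi * I / p)
  have hfα' : f α = Real.sqrt p := by
    rw [eq_comm, Real.sqrt_eq_iff_eq_sq hp0.le hfα, ← map_pow, hα, map_natCast]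
  have hfε : f ((ε : 𝓞 K) : K) = (t + u * Real.sqrt p) / 2 := by
    rw [hε, map_div₀, map_add, map_mul, hfα', map_ofNat]
    simp
  have hτ : ∃ e : ℝ, (e = 1 ∨ e = -1) ∧
      ∑ c : ZMod p, (quadraticChar (ZMod p) c : ℂ) * ζ ^ c.val = (e * Real.sqrt p : ℝ) := by
    have h1 := sq_sum_quadraticChar_mul_pow hp4 hζ
    have h2 : (p : ℂ) = (Real.sqrt p : ℂ) ^ 2 := by
      rw [← ofReal_pow, Real.sq_sqrt hp0.le, ofReal_natCast]
    rw [h2, sq_eq_sq_iff_eq_or_eq_neg] at h1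
    rcases h1 with h | h
    · exact ⟨1, Or.inl rfl, by rw [h, one_mul]⟩
    · exact ⟨-1, Or.inr rfl, by rw [h]; simp⟩
  obtain ⟨e, he, hτ⟩ := hτ
  have hlog := two_mul_classNumber_mul_log hp4 hζ hα hgen f hε1 hfund hτ
  have hprod := prod_quadraticResidues_one_sub_pow hp4 hζ
  set S := ∑ c ∈ quadraticResidues p, Real.log ‖1 - ζ ^ c.val‖
  have hpow : f ((ε : 𝓞 K) : K) ^ classNumber K =
      Real.exp (classNumber K * Real.log (f ((ε : 𝓞 K) : K))) := by
    rw [Real.exp_nat_mul, Real.exp_log (by linarith)]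
  have hsqrt : Real.sqrt p = Real.exp (Real.log p / 2) := by
    rw [← Real.log_sqrt hp0.le, Real.exp_log (Real.sqrt_pos.2 hp0)]
  refine natCast_pow_eq_of_unit_relation (L := ℂ) hp4 hζ (s := (Real.sqrt p : ℝ)) (e := (e : ℝ))
    ?_ t u (classNumber K) (by rw [hτ, ofReal_mul]) ?_
  · exact_mod_cast he
  · rw [hprod]
    rcases he with rfl | rfl
    · refine Or.inl ⟨ofReal_one, ?_⟩
      have : ((t + u * Real.sqrt p) / 2) ^ classNumber K * Real.exp S = Real.sqrt p := by
        rw [← hfε, hpow, hsqrt, ← Real.exp_add]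
        congr 1
        linarith
      exact_mod_cast this
    · refine Or.inr ⟨by simp, ?_⟩
      have : Real.exp S = Real.sqrt p * ((t + u * Real.sqrt p) / 2) ^ classNumber K := by
        rw [← hfε, hpow]
        conv_rhs => rw [hsqrt, ← Real.exp_add]
        congr 1
        linarith
      exact_mod_cast this

theorem two_mul_factorial_eq_of_pow_eq (hp4 : p % 4 = 1) {t h : ℕ} {N : ZMod p}
    (ht : (t : ZMod p) ^ 2 = 4 ∨ (t : ZMod p) ^ 2 = -4) (hN : N ^ 2 = -1)
    (hpow : (t : ZMod p) ^ h = -2 ^ h * N) : 2 * N = (-1) ^ ((h + 1) / 2) * t := by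
  have h2 : (2 : ZMod p) ≠ 0 := Ring.two_ne_zero (by rw [ZMod.ringChar_zmod_n]; omega)
  have h4 : (4 : ZMod p) = 2 ^ 2 := by norm_num
  have h40 : (4 : ZMod p) ≠ 0 := h4 ▸ pow_ne_zero 2 h2
  obtain ⟨k, rfl | rfl⟩ := Nat.even_or_odd' h
  · exfalso
    rw [pow_mul, pow_mul] at hpow
    have hN1 : N ^ 2 = 1 := by
      have hk : ((t : ZMod p) ^ 2) ^ k * ((t : ZMod p) ^ 2) ^ k = 4 ^ k * 4 ^ k := by
        rcases ht with h | h
        · rw [h]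
        · rw [h, ← mul_pow, neg_mul_neg, mul_pow]
      rw [hpow, ← h4] at hk
      have h4k : (4 : ZMod p) ^ k * 4 ^ k ≠ 0 :=
        mul_ne_zero (pow_ne_zero k h40) (pow_ne_zero k h40)
      exact mul_left_cancel₀ h4k (by linear_combination hk)
    exact h2 (by linear_combination hN - hN1)
  · rw [pow_succ (t : ZMod p) (2 * k), pow_mul (t : ZMod p) 2 k, pow_succ (2 : ZMod p) (2 * k),
      pow_mul (2 : ZMod p) 2 k, ← h4] at hpow
    rcases ht with h | h
    · exfalso
      rw [h] at hpow
      have hts : (t : ZMod p) = -2 * N :=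
        mul_left_cancel₀ (pow_ne_zero k h40) (by linear_combination hpow)
      rw [hts] at h
      have : (4 : ZMod p) * 2 = 0 := by linear_combination 4 * hN - h
      exact mul_ne_zero h40 h2 this
    · rw [h, neg_pow] at hpow
      have hts : (-1) ^ k * (t : ZMod p) = -2 * N :=
        mul_left_cancel₀ (pow_ne_zero k h40) (by linear_combination hpow)
      rw [show (2 * k + 1 + 1) / 2 = k + 1 by omega, pow_succ]
      linear_combination hts

end QuadraticResidueProduct
/-- Let `p ≡ 1 (mod 4)` be a prime, `K = ℚ(√p)` with class number `h = h(p)` and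
fundamental unit `ε = (t + u√p)/2 > 1`.  For a positive integer `a` with `gcd(a,p) = 1`,
in `𝔽_p` one has `2·Tr(θ^{Z_a}) = (-1)^{(h+1)/2} (−2a/p) t`. -/
theorem trace_eq_classNumber_sign_real
    (p : ℕ) [Fact p.Prime] (hp4 : p % 4 = 1)
    (K : Type*) [Field K] [NumberField K]
    (α : K) (hα : α ^ 2 = (p : K)) (hgen : Algebra.adjoin ℚ {α} = ⊤)
    (f : K →+* ℝ) (hfα : 0 ≤ f α)
    (t u : ℕ) (ht : 0 < t) (hu : 0 < u)
    (ε : (𝓞 K)ˣ) (hε : ((ε : 𝓞 K) : K) = ((t : K) + (u : K) * α) / 2)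
    (hε1 : 1 < f ((ε : 𝓞 K) : K))
    (hfund : ∀ v : (𝓞 K)ˣ, ∃ n : ℤ, v = ε ^ n ∨ v = -ε ^ n)
    (h : ℕ) (hh : h = NumberField.classNumber K)
    (F : Type*) [Field F] [Fintype F] [Algebra (ZMod p) F]
    (hcard : Fintype.card F = p ^ p)
    (θ : F) (hθ : θ ^ p = θ + 1)
    (a : ℕ) (ha : 1 ≤ a) (hap : Nat.gcd a p = 1) :
    2 * Algebra.trace (ZMod p) F (θ ^ ZetaRep p a) =
      (-1) ^ ((h + 1) / 2) * ((legendreSym p (-2 * a) : ℤ) : ZMod p) * (t : ZMod p) := by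
  obtain ⟨m, hm⟩ : ∃ m, p = 4 * m + 1 := ⟨p / 4, by omega⟩
  have ht2 : (t : ZMod p) ^ 2 = 4 ∨ (t : ZMod p) ^ 2 = -4 := by
    rcases sq_sub_mul_sq_eq_of_unit Fact.out hα hgen hm hε with h | h
    · left
      simpa using congrArg (Int.cast (R := ZMod p)) h
    · right
      simpa using congrArg (Int.cast (R := ZMod p)) h
  have key := two_mul_factorial_eq_of_pow_eq hp4 ht2 (ZMod.natCast_factorial_half_sq hp4)
    (natCast_pow_classNumber_eq hp4 hα hgen f hfα hε hε1 hfund)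
  rw [trace_zetaRep_eq_legendreSym_mul_factorial hp4 hcard hθ ha hap, hh]
  linear_combination ((legendreSym p (-2 * a) : ℤ) : ZMod p) * key
end

section
/- Let p be a prime, let a ≥ 1 and m ≥ 0 be integers with gcd(a, p) = 1, and let ā denote the image of a in 𝔽_p. Then in 𝔽_p one has ā^m · b_m(ā^{−1}) = − Tr(θ^{τ_p(a)}) · Tr(θ^m · θ^{−1−τ_p(a)}), where b_m(ā^{−1}) denotes the evaluation at ā^{−1} ∈ 𝔽_p of the Bell polynomial b_m(x) reduced modulo p, and θ^{−1−τ_p(a)} denotes the inverse of θ^{1+τ_p(a)} in 𝔽_{p^p}^×. -/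
/-- Stirling numbers of the second kind. -/
def stirling2 : ℕ → ℕ → ℕ
  | 0, 0 => 1
  | 0, _ + 1 => 0
  | _ + 1, 0 => 0
  | n + 1, j + 1 => (j + 1) * stirling2 n (j + 1) + stirling2 n j

/-- Evaluation of the Bell polynomial `b_n(x) = ∑_j S(n,j) x^j`. -/
def bellEval {R : Type*} [CommRing R] (n : ℕ) (x : R) : R :=
  ∑ j ∈ Finset.range (n + 1), (stirling2 n j : R) * x ^ j

/-- `τ_p(a) = ∑_{j=1}^{p-1} j p^{ja-1}`. -/
def tauP (p a : ℕ) : ℕ := ∑ j ∈ Finset.Icc 1 (p - 1), j * p ^ (j * a - 1)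

theorem stirling2_eq_zero_of_lt : ∀ {n j : ℕ}, n < j → stirling2 n j = 0
  | 0, 0, h => absurd h (lt_irrefl 0)
  | 0, _ + 1, _ => rfl
  | _ + 1, 0, h => absurd h (Nat.not_lt_zero _)
  | n + 1, j + 1, h => by
    rw [stirling2, stirling2_eq_zero_of_lt (by omega : n < j + 1),
      stirling2_eq_zero_of_lt (by omega : n < j), mul_zero]

/-- A sequence `s` on which multiplication by `x` acts as on the falling factorials with
step `a`, divided by powers of `a`, expands the powers of `x` through Stirling numbers. -/
theorem pow_eq_sum_stirling2 {R : Type*} [CommRing R] {x a : R} {s : ℕ → R} (h0 : s 0 = 1)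
    (hs : ∀ j, x * s j = a * (s (j + 1) + j * s j)) (m : ℕ) :
    x ^ m = a ^ m * ∑ j ∈ Finset.range (m + 1), (stirling2 m j : R) * s j := by
  induction m with
  | zero => simp [stirling2, h0]
  | succ m ih =>
    have h1 : ∑ j ∈ Finset.range (m + 1), (stirling2 m j : R) * (j * s j) =
        ∑ j ∈ Finset.range (m + 1), (stirling2 m (j + 1) : R) * ((j + 1 : ℕ) * s (j + 1)) := by
      have h := Finset.sum_range_succ' (fun j => (stirling2 m j : R) * (j * s j)) (m + 1)
      rw [Finset.sum_range_succ, stirling2_eq_zero_of_lt m.lt_succ_self] at h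
      simpa using h
    have h2 : x * ∑ j ∈ Finset.range (m + 1), (stirling2 m j : R) * s j =
        a * ∑ j ∈ Finset.range (m + 1), ((stirling2 m j : R) * s (j + 1) +
          (stirling2 m j : R) * (j * s j)) := by
      rw [Finset.mul_sum, Finset.mul_sum]
      refine Finset.sum_congr rfl fun j _ => ?_
      linear_combination (stirling2 m j : R) * hs j
    rw [Finset.sum_range_succ', pow_succ', ih, mul_left_comm, h2, Finset.sum_add_distrib, h1,
      ← Finset.sum_add_distrib, pow_succ, mul_assoc]
    simp only [stirling2, Nat.cast_zero, zero_mul, add_zero]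
    congr 2
    refine Finset.sum_congr rfl fun j _ => ?_
    push_cast
    ring

/-- The telescoping identity behind the transformation law of `θ ^ τ` under Frobenius. -/
theorem sum_succ_mul_mul_add_sum {e : ℕ → ℕ} {q : ℕ} (he : ∀ j, e j * q = e (j + 1)) (n : ℕ) :
    (∑ j ∈ Finset.range n, (j + 1) * e j) * q + ∑ j ∈ Finset.range (n + 1), e j =
      (∑ j ∈ Finset.range n, (j + 1) * e j) + (n + 1) * e n := by
  induction n with
  | zero => simp
  | succ n ih =>
    rw [Finset.sum_range_succ (fun j => (j + 1) * e j), Finset.sum_range_succ e (n + 1)]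
    have := he n
    linear_combination ih + (n + 1) * this

theorem tauP_eq_sum_range (p a : ℕ) :
    tauP p a = ∑ j ∈ Finset.range (p - 1), (j + 1) * p ^ ((j + 1) * a - 1) := by
  rw [tauP, Finset.range_eq_Ico, Finset.sum_Ico_add' (fun j => j * p ^ (j * a - 1)) 0 (p - 1) 1]
  rfl

section ZModReindex

variable {p : ℕ} [Fact p.Prime]

@[to_additive]
theorem prod_range_natCast_zmod {M : Type*} [CommMonoid M] (f : ZMod p → M) :
    ∏ k ∈ Finset.range p, f k = ∏ c, f c := by
  refine Finset.prod_bij' (fun k _ => (k : ZMod p)) (fun c _ => c.val) (by simp)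
    (fun c _ => Finset.mem_range.2 c.val_lt)
    (fun k hk => ZMod.val_cast_of_lt (Finset.mem_range.1 hk)) (by simp) (by simp)

@[to_additive]
theorem prod_range_mul_natCast_zmod {M : Type*} [CommMonoid M] (f : ZMod p → M) {a : ZMod p}
    (ha : a ≠ 0) : ∏ k ∈ Finset.range p, f (a * k) = ∏ c, f c := by
  rw [prod_range_natCast_zmod (fun c => f (a * c))]
  exact Equiv.prod_comp (Equiv.mulLeft₀ a ha) f

theorem prod_add_algebraMap_zmod {F : Type*} [Field F] [Algebra (ZMod p) F] (x : F) :
    ∏ c : ZMod p, (x + algebraMap (ZMod p) F c) = x ^ p - x := by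
  have hp : 1 < p := (Fact.out : p.Prime).one_lt
  have hroots := FiniteField.roots_X_pow_card_sub_X (ZMod p)
  have hdeg := FiniteField.X_pow_card_sub_X_natDegree_eq (ZMod p) hp
  rw [ZMod.card] at hroots
  have hmonic : (Polynomial.X ^ p - Polynomial.X : Polynomial (ZMod p)).Monic :=
    Polynomial.monic_X_pow_sub (by simpa using hp)
  have h := Polynomial.prod_multiset_X_sub_C_of_monic_of_roots_card_eq hmonic
    (by rw [hroots, hdeg]; simp [ZMod.card])
  rw [hroots] at h
  have h' := congrArg (Polynomial.aeval x) h
  change Polynomial.aeval x (∏ c : ZMod p, (Polynomial.X - Polynomial.C c)) = _ at h'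
  rw [map_prod] at h'
  simp only [map_sub, map_pow, Polynomial.aeval_X, Polynomial.aeval_C] at h'
  rw [← h', ← Equiv.prod_comp (Equiv.neg (ZMod p))]
  simp [sub_eq_add_neg]

end ZModReindex

theorem pow_prime_pow_val {p : ℕ} {F : Type*} [Field F] [Fintype F]
    (hcard : Fintype.card F = p ^ p) (x : F) (n : ℕ) :
    x ^ p ^ (n : ZMod p).val = x ^ p ^ n := by
  rw [ZMod.val_natCast]
  conv_rhs => rw [← Nat.mod_add_div n p, pow_add, pow_mul, pow_mul p p, ← hcard,
    FiniteField.pow_card_pow]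

theorem natCast_pow_prime_pow {p : ℕ} [Fact p.Prime] {F : Type*} [Field F]
    [Algebra (ZMod p) F] (k n : ℕ) : (k : F) ^ p ^ n = k := by
  rw [← map_natCast (algebraMap (ZMod p) F), ← map_pow, ZMod.pow_card_pow]

theorem pow_prime_pow_eq_add_natCast {p : ℕ} [Fact p.Prime] {F : Type*} [Field F]
    [Algebra (ZMod p) F] {θ : F} (hθ : θ ^ p = θ + 1) (n : ℕ) :
    θ ^ p ^ n = θ + n := by
  have : CharP F p := charP_of_injective_algebraMap (algebraMap (ZMod p) F).injective p
  induction n with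
  | zero => simp
  | succ n ih =>
    have h := natCast_pow_prime_pow (p := p) (F := F) n 1
    rw [pow_one] at h
    rw [pow_succ, pow_mul, ih, add_pow_char, hθ, h]
    push_cast
    ring

section ArtinSchreier

variable {p : ℕ} [Fact p.Prime] {F : Type*} [Field F] [Fintype F] [Algebra (ZMod p) F]

theorem finrank_zmod_of_card (hcard : Fintype.card F = p ^ p) :
    Module.finrank (ZMod p) F = p := by
  have h := Module.card_eq_pow_finrank (K := ZMod p) (V := F)
  rw [hcard, ZMod.card] at h
  exact (Nat.pow_right_injective (Fact.out : p.Prime).two_le h).symm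

theorem algebraMap_trace_eq_sum_range (hcard : Fintype.card F = p ^ p) (x : F) :
    algebraMap (ZMod p) F (Algebra.trace (ZMod p) F x) = ∑ k ∈ Finset.range p, x ^ p ^ k := by
  rw [FiniteField.algebraMap_trace_eq_sum_pow, finrank_zmod_of_card hcard, Nat.card_zmod]

theorem trace_pow_prime_pow (x : F) (n : ℕ) :
    Algebra.trace (ZMod p) F (x ^ p ^ n) = Algebra.trace (ZMod p) F x := by
  induction n with
  | zero => simp
  | succ n ih =>
    rw [pow_succ, pow_mul, ← ih]
    have h := Algebra.trace_eq_of_algEquiv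
      (FiniteField.frobeniusAlgEquivOfAlgebraic (ZMod p) F) (x ^ p ^ n)
    simpa [ZMod.card] using h

/-- The trace is the sum over the powers of any generator of the Galois group. -/
theorem algebraMap_trace_eq_sum_range_mul (hcard : Fintype.card F = p ^ p) {a : ℕ}
    (ha : (a : ZMod p) ≠ 0) (x : F) :
    algebraMap (ZMod p) F (Algebra.trace (ZMod p) F x) =
      ∑ k ∈ Finset.range p, x ^ p ^ (a * k) := by
  have h1 := sum_range_natCast_zmod (fun c : ZMod p => x ^ p ^ c.val)
  have h2 := sum_range_add_natCast_zmod (fun c : ZMod p => x ^ p ^ c.val) ha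
  rw [algebraMap_trace_eq_sum_range hcard]
  simp only [← Nat.cast_mul, pow_prime_pow_val hcard] at h1 h2
  rw [h1, h2]


theorem sum_zmod_pow_of_le {n : ℕ} (hn : n ≤ p - 1) :
    ∑ c : ZMod p, c ^ n = if n = p - 1 then -1 else 0 := by
  split_ifs with h
  · simp only [h, ZMod.pow_card_sub_one, Finset.sum_boole]
    rw [Finset.filter_ne' Finset.univ 0, Finset.card_erase_of_mem (Finset.mem_univ _),
      Finset.card_univ, ZMod.card, Nat.cast_sub (Fact.out : p.Prime).one_le]
    simp
  · exact FiniteField.sum_pow_lt_card_sub_one (ZMod p) n (by rw [ZMod.card]; omega)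

theorem trace_pow_of_le (hcard : Fintype.card F = p ^ p) {θ : F} (hθ : θ ^ p = θ + 1) {n : ℕ}
    (hn : n ≤ p - 1) :
    Algebra.trace (ZMod p) F (θ ^ n) = if n = p - 1 then -1 else 0 := by
  apply (algebraMap (ZMod p) F).injective
  have h := sum_range_natCast_zmod (fun c : ZMod p => (θ + algebraMap (ZMod p) F c) ^ n)
  simp only [map_natCast] at h
  have h' : ∀ k : ℕ, (θ ^ n) ^ p ^ k = (θ + k) ^ n := fun k => by
    rw [pow_right_comm, pow_prime_pow_eq_add_natCast hθ]
  simp only [algebraMap_trace_eq_sum_range hcard, h']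
  rw [h]
  simp only [add_pow]
  rw [Finset.sum_comm]
  simp only [← map_pow, mul_assoc, ← Finset.mul_sum, ← Finset.sum_mul, ← map_sum]
  rw [Finset.sum_eq_single 0]
  · rw [Nat.sub_zero, sum_zmod_pow_of_le hn]
    simp
  · intro i hi hi0
    rw [Finset.mem_range] at hi
    rw [sum_zmod_pow_of_le (by omega), if_neg (by omega)]
    simp
  · simp

theorem trace_aeval_of_monic (hcard : Fintype.card F = p ^ p) {θ : F} (hθ : θ ^ p = θ + 1)
    {f : Polynomial (ZMod p)} (hf : f.Monic) (hn : f.natDegree ≤ p - 1) :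
    Algebra.trace (ZMod p) F (Polynomial.aeval θ f) =
      if f.natDegree = p - 1 then -1 else 0 := by
  rw [Polynomial.aeval_eq_sum_range, map_sum, Finset.sum_range_succ, Finset.sum_eq_zero]
  · simp [trace_pow_of_le hcard hθ hn, hf.coeff_natDegree]
  · intro i hi
    rw [Finset.mem_range] at hi
    rw [map_smul, trace_pow_of_le hcard hθ (by omega), if_neg (by omega), smul_zero]

theorem trace_prod_add (hcard : Fintype.card F = p ^ p) {θ : F} (hθ : θ ^ p = θ + 1) (a : ℕ)
    {n : ℕ} (hn : n ≤ p - 1) :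
    Algebra.trace (ZMod p) F (∏ i ∈ Finset.range n, (θ + a * i)) =
      if n = p - 1 then -1 else 0 := by
  have hmonic : (∏ i ∈ Finset.range n,
      (Polynomial.X + Polynomial.C (a * i : ZMod p))).Monic :=
    Polynomial.monic_prod_of_monic _ _ fun i _ => Polynomial.monic_X_add_C _
  have hdeg : (∏ i ∈ Finset.range n,
      (Polynomial.X + Polynomial.C (a * i : ZMod p))).natDegree = n := by
    rw [Polynomial.natDegree_prod_of_monic _ _ fun i _ => Polynomial.monic_X_add_C _]
    simp only [Polynomial.natDegree_X_add_C]
    simp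
  have h := trace_aeval_of_monic hcard hθ hmonic (hdeg.symm ▸ hn)
  rw [hdeg] at h
  rw [← h, map_prod (Polynomial.aeval (R := ZMod p) θ)]
  simp

theorem pow_tauP_pow (hcard : Fintype.card F = p ^ p) {θ : F} (hθ : θ ^ p = θ + 1) {a : ℕ}
    (ha : 1 ≤ a) (hap : (a : ZMod p) ≠ 0) :
    (θ ^ tauP p a) ^ p ^ a = θ ^ tauP p a * θ := by
  have : CharP F p := charP_of_injective_algebraMap (algebraMap (ZMod p) F).injective p
  have hp : 1 ≤ p := (Fact.out : p.Prime).one_le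
  have hexp : ∀ j, p ^ ((j + 1) * a - 1) * p ^ a = p ^ ((j + 1 + 1) * a - 1) := fun j => by
    rw [← pow_add]
    congr 1
    have : 1 ≤ (j + 1) * a := Nat.mul_pos j.succ_pos ha
    rw [add_mul (j + 1) 1 a]
    omega
  have hexp' : ∀ j, p ^ ((j + 1) * a - 1) * p = p ^ (a * j + a) := fun j => by
    rw [← pow_succ]
    congr 1
    have : 1 ≤ (j + 1) * a := Nat.mul_pos j.succ_pos ha
    rw [Nat.sub_add_cancel this]
    ring
  have hsum := sum_succ_mul_mul_add_sum hexp (p - 1)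
  rw [← tauP_eq_sum_range, Nat.sub_add_cancel hp] at hsum
  have hnorm : θ ^ ∑ j ∈ Finset.range p, p ^ ((j + 1) * a - 1) = 1 := by
    apply frobenius_inj F p
    rw [frobenius_def, map_one, ← pow_mul, Finset.sum_mul, Finset.sum_congr rfl fun j _ => hexp' j,
      ← Finset.prod_pow_eq_pow_sum]
    have h := prod_range_mul_natCast_zmod
      (fun c : ZMod p => θ + a + algebraMap (ZMod p) F c) hap
    rw [prod_add_algebraMap_zmod, add_pow_char, hθ] at h
    have haF := natCast_pow_prime_pow (p := p) (F := F) a 1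
    rw [pow_one] at haF
    rw [haF] at h
    refine (Finset.prod_congr rfl fun j _ => ?_).trans (h.trans (by ring))
    rw [pow_prime_pow_eq_add_natCast hθ]
    simp only [map_mul, map_natCast]
    push_cast
    ring
  have hlast : θ ^ (p * p ^ (p * a - 1)) = θ := by
    have := hexp' (p - 1)
    rw [Nat.sub_add_cancel hp] at this
    rw [mul_comm, this, ← Nat.mul_succ, Nat.succ_eq_add_one, Nat.sub_add_cancel hp, mul_comm,
      pow_mul p p a, ← hcard, FiniteField.pow_card_pow]
  have h := congrArg (θ ^ ·) hsum
  simp only [pow_add, hnorm, hlast, mul_one] at h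
  rw [← pow_mul, h]

theorem pow_prime_pow_mul_eq_mul_prod {p : ℕ} [Fact p.Prime] {F : Type*} [Field F]
    [Algebra (ZMod p) F] {θ : F} (hθ : θ ^ p = θ + 1) {a : ℕ} {u : F}
    (hu : u ^ p ^ a = u * θ) (n : ℕ) :
    u ^ p ^ (a * n) = u * ∏ i ∈ Finset.range n, (θ + a * i) := by
  induction n with
  | zero => simp
  | succ n ih =>
    have h : (∏ i ∈ Finset.range n, (θ + a * i)) ^ p ^ a =
        ∏ i ∈ Finset.range n, (θ + a * (i + 1 : ℕ)) := by
      have : CharP F p := charP_of_injective_algebraMap (algebraMap (ZMod p) F).injective p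
      rw [← Finset.prod_pow]
      refine Finset.prod_congr rfl fun i _ => ?_
      rw [← Nat.cast_mul, add_pow_char_pow, pow_prime_pow_eq_add_natCast hθ,
        natCast_pow_prime_pow]
      push_cast
      ring
    rw [Nat.mul_succ, pow_add, pow_mul, ih, mul_pow, hu, h, Finset.prod_range_succ']
    simp
    ring

theorem trace_mul_trace_inv (hcard : Fintype.card F = p ^ p) {θ : F} (hθ : θ ^ p = θ + 1)
    {a : ℕ} (hap : (a : ZMod p) ≠ 0) {u : F} (hu0 : u ≠ 0) (hu : u ^ p ^ a = u * θ) :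
    Algebra.trace (ZMod p) F u * Algebra.trace (ZMod p) F u⁻¹ = -1 := by
  have hp : 1 ≤ p := (Fact.out : p.Prime).one_le
  rw [← smul_eq_mul, ← map_smul, Algebra.smul_def, algebraMap_trace_eq_sum_range_mul hcard hap,
    Finset.sum_mul, map_sum]
  have h : ∀ n, u ^ p ^ (a * n) * u⁻¹ = ∏ i ∈ Finset.range n, (θ + a * i) := fun n => by
    rw [pow_prime_pow_mul_eq_mul_prod hθ hu, mul_comm u, mul_inv_cancel_right₀ hu0]
  simp only [h]
  rw [Finset.sum_congr rfl fun n hn => trace_prod_add hcard hθ a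
    (Nat.le_sub_one_of_lt (Finset.mem_range.1 hn)), Finset.sum_ite_eq' (Finset.range p) (p - 1),
    if_pos (Finset.mem_range.2 (Nat.sub_lt hp one_pos))]

theorem trace_prod_sub_mul {θ : F} (hθ : θ ^ p = θ + 1) {a : ℕ} {v w : F}
    (hv : θ * w = v) (hw : v ^ p ^ a = w) (n : ℕ) :
    Algebra.trace (ZMod p) F ((∏ i ∈ Finset.range n, (θ - a * i)) * w) =
      Algebra.trace (ZMod p) F w := by
  induction n with
  | zero => simp
  | succ n ih =>
    have h : (∏ i ∈ Finset.range n, (θ - a * (i + 1 : ℕ))) ^ p ^ a =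
        ∏ i ∈ Finset.range n, (θ - a * i) := by
      have : CharP F p := charP_of_injective_algebraMap (algebraMap (ZMod p) F).injective p
      rw [← Finset.prod_pow]
      refine Finset.prod_congr rfl fun i _ => ?_
      rw [← Nat.cast_mul, sub_pow_char_pow, pow_prime_pow_eq_add_natCast hθ,
        natCast_pow_prime_pow]
      push_cast
      ring
    rw [Finset.prod_range_succ', Nat.cast_zero, mul_zero, sub_zero, mul_assoc, hv,
      ← trace_pow_prime_pow _ a, mul_pow, h, hw, ih]

end ArtinSchreier

/-- The trace formula: `a^m b_m(a⁻¹) = - Tr(θ^{τ_p(a)}) Tr(θ^{m-1-τ_p(a)})` in `𝔽_p`. -/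
theorem bell_trace_formula
    (p : ℕ) [Fact p.Prime]
    (F : Type*) [Field F] [Fintype F] [Algebra (ZMod p) F]
    (hcard : Fintype.card F = p ^ p)
    (θ : F) (hθ : θ ^ p = θ + 1)
    (a m : ℕ) (ha : 1 ≤ a) (hap : Nat.gcd a p = 1) :
    (a : ZMod p) ^ m * bellEval m ((a : ZMod p)⁻¹) =
      - Algebra.trace (ZMod p) F (θ ^ tauP p a) *
        Algebra.trace (ZMod p) F (θ ^ m * (θ ^ (1 + tauP p a))⁻¹) := by
  have hap' : (a : ZMod p) ≠ 0 := ((ZMod.isUnit_iff_coprime a p).2 hap).ne_zero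
  have haF : (a : F) ≠ 0 := by
    rw [← map_natCast (algebraMap (ZMod p) F)]
    exact (map_ne_zero _).2 hap'
  have hθ0 : θ ≠ 0 := by
    rintro rfl
    rw [zero_pow (Fact.out : p.Prime).ne_zero] at hθ
    simp at hθ
  set u := θ ^ tauP p a with hu_def
  have hu0 : u ≠ 0 := pow_ne_zero _ hθ0
  have hu : u ^ p ^ a = u * θ := pow_tauP_pow hcard hθ ha hap'
  set w := (θ ^ (1 + tauP p a))⁻¹ with hw_def
  have hv : θ * w = u⁻¹ := by
    rw [hw_def, pow_add, pow_one, mul_inv, mul_inv_cancel_left₀ hθ0]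
  have hw : u⁻¹ ^ p ^ a = w := by
    rw [inv_pow, hu, hw_def, pow_add, pow_one, mul_comm]
  have htr : Algebra.trace (ZMod p) F u * Algebra.trace (ZMod p) F w = -1 := by
    rw [← hw, trace_pow_prime_pow]
    exact trace_mul_trace_inv hcard hθ hap' hu0 hu
  have hexpand := pow_eq_sum_stirling2 (x := θ) (a := (a : F))
    (s := fun j => (a : F)⁻¹ ^ j * ∏ i ∈ Finset.range j, (θ - a * i)) (by simp)
    (fun j => by
      rw [Finset.prod_range_succ, pow_succ]
      field_simp
      ring) m
  have hmoment : Algebra.trace (ZMod p) F (θ ^ m * w) =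
      (a : ZMod p) ^ m * bellEval m ((a : ZMod p)⁻¹) * Algebra.trace (ZMod p) F w := by
    have hsmul : θ ^ m * w = (a : ZMod p) ^ m • ∑ j ∈ Finset.range (m + 1),
        ((stirling2 m j : ZMod p) * (a : ZMod p)⁻¹ ^ j) •
          ((∏ i ∈ Finset.range j, (θ - a * i)) * w) := by
      simp only [hexpand, Algebra.smul_def, map_mul, map_pow, map_inv₀, map_natCast, mul_assoc,
        Finset.sum_mul]
    rw [hsmul, map_smul, map_sum]
    simp only [map_smul, trace_prod_sub_mul hθ hv hw]
    rw [← Finset.sum_smul, bellEval, smul_eq_mul, smul_eq_mul, mul_assoc]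
  rw [hmoment]
  linear_combination ((a : ZMod p) ^ m * bellEval m ((a : ZMod p)⁻¹)) * htr
end
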